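/- arXiv:1905.11504 — 5 statements merged into one kernel-verified Lean document; each statement's English description precedes it below -/
import Mathlib

section
/- Let 0 < λ < λ*(α) and let u be a minimal solution of (P_{α,λ}), i.e. a solution such that u ≤ v pointwise on [0,1] for every solution v of (P_{α,λ}). Then u is semistable: ∫₀¹ η'(r)² μ(r) r dr ≥ λ ∫₀¹ ψ(r) f'(u(r)) η(r)² μ(r) r dr for every C¹ function η : [0,1] → ℝ with η(1) = 0. -/
open Set MeasureTheory Filter

/-- The standing data and assumptions of the Gelfand-type problem for
auto-ignition of a free round turbulent jet:
`f : [0,∞) → (0,∞)` is `C¹`, convex, non-decreasing with `K = ∫₀^∞ ds / f s < ∞`;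
`φ, ψ : [0,1] → [0,∞)` are non-increasing Lipschitz with `φ 0 = ψ 0 = 1`,
`φ > 0` on `[0,1)`, and `M s = max_{r ∈ [0,s]} ψ r / φ r` is integrable on `(0,1)`. -/
structure GelfandData where
  f : ℝ → ℝ
  phi : ℝ → ℝ
  psi : ℝ → ℝ
  M : ℝ → ℝ
  K : ℝ
  f_pos : ∀ s, 0 ≤ s → 0 < f s
  f_smooth : ContDiffOn ℝ 1 f (Ici 0)
  f_convex : ConvexOn ℝ (Ici 0) f
  f_mono : MonotoneOn f (Ici 0)
  f_int : IntegrableOn (fun s => 1 / f s) (Ioi 0)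
  K_def : K = ∫ s in Ioi (0:ℝ), 1 / f s
  phi_nonneg : ∀ r ∈ Icc (0:ℝ) 1, 0 ≤ phi r
  psi_nonneg : ∀ r ∈ Icc (0:ℝ) 1, 0 ≤ psi r
  phi_anti : AntitoneOn phi (Icc 0 1)
  psi_anti : AntitoneOn psi (Icc 0 1)
  phi_lip : ∃ L, LipschitzOnWith L phi (Icc 0 1)
  psi_lip : ∃ L, LipschitzOnWith L psi (Icc 0 1)
  phi_zero : phi 0 = 1
  psi_zero : psi 0 = 1
  phi_pos : ∀ r ∈ Ico (0:ℝ) 1, 0 < phi r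
  M_def : ∀ s ∈ Ico (0:ℝ) 1, IsGreatest ((fun r => psi r / phi r) '' Icc 0 s) (M s)
  M_int : IntegrableOn M (Ioo 0 1)

/-- `u` is a (classical, radial) solution of problem `(P_{α,λ})`:
`u ∈ C²((0,1)) ∩ C¹([0,1])`, `u > 0` on `[0,1)`, `u'(0) = 0`, `u 1 = 0`, and
`-u'' - (1/r + α r φ(r)) u' = λ ψ(r) f(u(r))` on `(0,1)`. -/
def IsSolution (D : GelfandData) (α lam : ℝ) (u : ℝ → ℝ) : Prop :=
  ContDiffOn ℝ 1 u (Icc 0 1) ∧ ContDiffOn ℝ 2 u (Ioo 0 1) ∧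
  (∀ r ∈ Ico (0:ℝ) 1, 0 < u r) ∧
  derivWithin u (Icc 0 1) 0 = 0 ∧ u 1 = 0 ∧
  ∀ r ∈ Ioo (0:ℝ) 1,
    -(derivWithin (derivWithin u (Icc 0 1)) (Ioo 0 1) r)
      - (1 / r + α * r * D.phi r) * derivWithin u (Icc 0 1) r
      = lam * D.psi r * D.f (u r)

/-- The set of `λ > 0` for which problem `(P_{α,λ})` admits a solution. -/
def solvableSet (D : GelfandData) (α : ℝ) : Set ℝ :=
  {lam | 0 < lam ∧ ∃ u, IsSolution D α lam u}

/-- The extremal Frank-Kamenetskii parameter `λ*(α)`. -/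
noncomputable def lamStar (D : GelfandData) (α : ℝ) : ℝ := sSup (solvableSet D α)

/-- The weight `μ(r) = exp(α ∫₀^r s φ(s) ds)`. -/
noncomputable def muW (D : GelfandData) (α r : ℝ) : ℝ :=
  Real.exp (α * ∫ s in (0:ℝ)..r, s * D.phi s)

/-- `u` is a semistable solution: for every `C¹` test function `η` with `η 1 = 0`,
`∫₀¹ η'^2 μ r dr ≥ λ ∫₀¹ ψ f'(u) η² μ r dr`. -/
def IsSemistable (D : GelfandData) (α lam : ℝ) (u : ℝ → ℝ) : Prop :=
  ∀ η : ℝ → ℝ, ContDiff ℝ 1 η → η 1 = 0 →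
    lam * ∫ r in Ioo (0:ℝ) 1,
        D.psi r * derivWithin D.f (Ici 0) (u r) * (η r) ^ 2 * muW D α r * r
      ≤ ∫ r in Ioo (0:ℝ) 1, (deriv η r) ^ 2 * muW D α r * r

open scoped Topology

namespace GSS

lemma ftc_open {g : ℝ → ℝ} (hg : ContinuousOn g (Icc 0 1)) {r : ℝ} (hr : r ∈ Ioo (0:ℝ) 1) :
    HasDerivAt (fun t => ∫ s in (0:ℝ)..t, g s) (g r) r := by
  apply intervalIntegral.integral_hasDerivAt_right
  · apply ContinuousOn.intervalIntegrable
    rw [uIcc_of_le hr.1.le]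
    exact hg.mono (Icc_subset_Icc le_rfl hr.2.le)
  · exact (hg.mono Ioo_subset_Icc_self).stronglyMeasurableAtFilter isOpen_Ioo r hr
  · exact hg.continuousAt (Icc_mem_nhds hr.1 hr.2)

lemma prim_cont {g : ℝ → ℝ} (hg : IntervalIntegrable g volume 0 1) :
    ContinuousOn (fun t => ∫ s in (0:ℝ)..t, g s) (Icc 0 1) := by
  have := intervalIntegral.continuousOn_primitive_interval (a := 0) (b := 1) (μ := volume) (f := g)
    (by rw [uIcc_of_le zero_le_one]; exact (intervalIntegrable_iff_integrableOn_Icc_of_le zero_le_one).1 hg)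
  rwa [uIcc_of_le zero_le_one] at this

lemma ii_of_cont {g : ℝ → ℝ} (hg : ContinuousOn g (Icc 0 1)) {a b : ℝ} (ha : a ∈ Icc (0:ℝ) 1)
    (hb : b ∈ Icc (0:ℝ) 1) : IntervalIntegrable g volume a b := by
  apply ContinuousOn.intervalIntegrable
  exact hg.mono (uIcc_subset_Icc ha hb)

lemma ftc_left {g : ℝ → ℝ} (hg : ContinuousOn g (Icc 0 1)) {r : ℝ} (hr : r ∈ Icc (0:ℝ) 1) :
    HasDerivWithinAt (fun t => ∫ s in t..(1:ℝ), g s) (-(g r)) (Icc 0 1) r := by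
  set G : ℝ → ℝ := Set.IccExtend (zero_le_one' ℝ) ((Icc (0:ℝ) 1).domRestrict g) with hG
  have hGc : Continuous G := (continuousOn_iff_continuous_domRestrict.1 hg).Icc_extend'
  have hGe : ∀ x ∈ Icc (0:ℝ) 1, G x = g x := by
    intro x hx
    simp [hG, Set.IccExtend_of_mem _ _ hx]
  have h1 : HasDerivAt (fun t => ∫ s in t..(1:ℝ), G s) (-(G r)) r :=
    intervalIntegral.integral_hasDerivAt_left (hGc.intervalIntegrable _ _)
      hGc.stronglyMeasurable.stronglyMeasurableAtFilter hGc.continuousAt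
  rw [hGe r hr] at h1
  have key : ∀ t ∈ Icc (0:ℝ) 1, (∫ s in t..(1:ℝ), g s) = ∫ s in t..(1:ℝ), G s := by
    intro t ht
    apply intervalIntegral.integral_congr
    intro s hs
    exact (hGe s (uIcc_subset_Icc ht ⟨zero_le_one, le_rfl⟩ hs)).symm
  exact h1.hasDerivWithinAt.congr key (key r hr)

variable (D : GelfandData) (α : ℝ)

lemma phi_cont : ContinuousOn D.phi (Icc 0 1) := by
  obtain ⟨L, h⟩ := D.phi_lip; exact h.continuousOn
lemma psi_cont : ContinuousOn D.psi (Icc 0 1) := by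
  obtain ⟨L, h⟩ := D.psi_lip; exact h.continuousOn

lemma sphi_cont : ContinuousOn (fun s => s * D.phi s) (Icc 0 1) :=
  continuousOn_id.mul (phi_cont D)

lemma mu_cont : ContinuousOn (muW D α) (Icc 0 1) := by
  have := prim_cont (ii_of_cont (sphi_cont D) (a := 0) (b := 1) (by simp) (by simp))
  exact Real.continuous_exp.comp_continuousOn (continuousOn_const.mul this)

lemma mu_pos (r : ℝ) : 0 < muW D α r := Real.exp_pos _

lemma mu_one (hα : 0 < α) {r : ℝ} (hr : r ∈ Icc (0:ℝ) 1) : 1 ≤ muW D α r := by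
  apply Real.one_le_exp
  apply mul_nonneg hα.le
  apply intervalIntegral.integral_nonneg hr.1
  intro s hs
  exact mul_nonneg hs.1 (D.phi_nonneg s ⟨hs.1, hs.2.trans hr.2⟩)

lemma mu_deriv {r : ℝ} (hr : r ∈ Ioo (0:ℝ) 1) :
    HasDerivAt (muW D α) (muW D α r * (α * (r * D.phi r))) r :=
  ((ftc_open (sphi_cont D) hr).const_mul α).exp

/-- weight -/
noncomputable def pW (r : ℝ) : ℝ := r * muW D α r

lemma p_cont : ContinuousOn (pW D α) (Icc 0 1) := continuousOn_id.mul (mu_cont D α)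

lemma p_pos {r : ℝ} (hr : 0 < r) : 0 < pW D α r := mul_pos hr (mu_pos D α r)

lemma p_nonneg {r : ℝ} (hr : 0 ≤ r) : 0 ≤ pW D α r := mul_nonneg hr (mu_pos D α r).le

lemma p_deriv {r : ℝ} (hr : r ∈ Ioo (0:ℝ) 1) :
    HasDerivAt (pW D α) (pW D α r * (1 / r + α * r * D.phi r)) r := by
  have h1 : HasDerivAt (pW D α) (1 * muW D α r + r * (muW D α r * (α * (r * D.phi r)))) r :=
    (hasDerivAt_id r).mul (mu_deriv D α hr)
  have h2 : pW D α r * (1 / r + α * r * D.phi r)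
      = 1 * muW D α r + r * (muW D α r * (α * (r * D.phi r))) := by
    have := hr.1.ne'
    unfold pW
    field_simp
  rw [h2]; exact h1

/-- flux -/
noncomputable def Hf (h : ℝ → ℝ) (t : ℝ) : ℝ := ∫ s in (0:ℝ)..t, pW D α s * h s
/-- minus derivative -/
noncomputable def Qf (h : ℝ → ℝ) (t : ℝ) : ℝ := Hf D α h t / pW D α t
/-- Green operator -/
noncomputable def Tf (h : ℝ → ℝ) (r : ℝ) : ℝ := ∫ t in r..(1:ℝ), Qf D α h t

lemma ph_ii {h : ℝ → ℝ} (hi : IntervalIntegrable h volume 0 1) :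
    IntervalIntegrable (fun s => pW D α s * h s) volume 0 1 := by
  apply hi.continuousOn_mul
  rw [uIcc_of_le zero_le_one]; exact p_cont D α

lemma H_cont {h : ℝ → ℝ} (hi : IntervalIntegrable h volume 0 1) :
    ContinuousOn (Hf D α h) (Icc 0 1) := prim_cont (ph_ii D α hi)

lemma Q_zero (h : ℝ → ℝ) : Qf D α h 0 = 0 := by simp [Qf, pW]

lemma Q_cont (hα : 0 < α) {h : ℝ → ℝ} {C : ℝ} (hi : IntervalIntegrable h volume 0 1)
    (hC : ∀ s ∈ Icc (0:ℝ) 1, |h s| ≤ C) : ContinuousOn (Qf D α h) (Icc 0 1) := by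
  intro r hr
  rcases hr.1.eq_or_lt with h0 | h0
  · subst h0
    have hC0 : 0 ≤ C := (abs_nonneg _).trans (hC 0 hr)
    obtain ⟨B, hB⟩ := isCompact_Icc.exists_bound_of_continuousOn (mu_cont D α)
    have hB0 : 0 ≤ B := (norm_nonneg _).trans (hB 0 hr)
    have bound : ∀ t ∈ Icc (0:ℝ) 1, |Qf D α h t| ≤ (B * C) * t := by
      intro t ht
      rcases ht.1.eq_or_lt with h0 | h0
      · subst h0; simp [Q_zero]
      · have h1 : ‖Hf D α h t‖ ≤ (t * B * C) * |t - 0| := by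
          apply intervalIntegral.norm_integral_le_of_norm_le_const
          intro s hs
          rw [uIoc_of_le ht.1] at hs
          have hs1 : s ∈ Icc (0:ℝ) 1 := ⟨hs.1.le, hs.2.trans ht.2⟩
          rw [pW, norm_mul, norm_mul, Real.norm_of_nonneg hs.1.le]
          gcongr
          · exact hs.2
          · exact hB s hs1
          · exact hC s hs1
        rw [sub_zero, abs_of_pos h0, Real.norm_eq_abs] at h1
        rw [Qf, abs_div, abs_of_pos (p_pos D α h0), div_le_iff₀ (p_pos D α h0)]
        refine h1.trans ?_
        have := mu_one D α hα ht
        rw [pW]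
        have h3 : 0 ≤ B * C * t * t := by positivity
        nlinarith
    rw [ContinuousWithinAt, Q_zero]
    apply squeeze_zero_norm' (a := fun t => (B * C) * t)
    · filter_upwards [self_mem_nhdsWithin] with t ht using bound t ht
    · have : Continuous (fun t : ℝ => (B * C) * t) := by fun_prop
      simpa using (this.tendsto 0).mono_left nhdsWithin_le_nhds
  · exact (H_cont D α hi r hr).div (p_cont D α r hr) (p_pos D α h0).ne'

lemma T_deriv (hα : 0 < α) {h : ℝ → ℝ} {C : ℝ} (hi : IntervalIntegrable h volume 0 1)
    (hC : ∀ s ∈ Icc (0:ℝ) 1, |h s| ≤ C) {r : ℝ} (hr : r ∈ Icc (0:ℝ) 1) :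
    HasDerivWithinAt (Tf D α h) (-(Qf D α h r)) (Icc 0 1) r :=
  ftc_left (Q_cont D α hα hi hC) hr

lemma ii_sub {h : ℝ → ℝ} (hi : IntervalIntegrable h volume 0 1) {a b : ℝ} (ha : a ∈ Icc (0:ℝ) 1)
    (hb : b ∈ Icc (0:ℝ) 1) : IntervalIntegrable h volume a b := by
  apply hi.mono_set
  rw [uIcc_of_le zero_le_one]; exact uIcc_subset_Icc ha hb

lemma H_mono {h k : ℝ → ℝ} (hi : IntervalIntegrable h volume 0 1)
    (ki : IntervalIntegrable k volume 0 1) (hk : ∀ s ∈ Icc (0:ℝ) 1, h s ≤ k s)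
    {t : ℝ} (ht : t ∈ Icc (0:ℝ) 1) : Hf D α h t ≤ Hf D α k t := by
  apply intervalIntegral.integral_mono_on ht.1
  · exact ii_sub (ph_ii D α hi) (by simp) ht
  · exact ii_sub (ph_ii D α ki) (by simp) ht
  · intro x hx
    exact mul_le_mul_of_nonneg_left (hk x ⟨hx.1, hx.2.trans ht.2⟩) (p_nonneg D α hx.1)

lemma Q_nonneg {h : ℝ → ℝ} (h0 : ∀ s ∈ Icc (0:ℝ) 1, 0 ≤ h s) {t : ℝ} (ht : t ∈ Icc (0:ℝ) 1) :
    0 ≤ Qf D α h t := by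
  apply div_nonneg _ (p_nonneg D α ht.1)
  apply intervalIntegral.integral_nonneg ht.1
  intro x hx
  exact mul_nonneg (p_nonneg D α hx.1) (h0 x ⟨hx.1, hx.2.trans ht.2⟩)

lemma T_mono (hα : 0 < α) {h k : ℝ → ℝ} {C C' : ℝ} (hi : IntervalIntegrable h volume 0 1)
    (hC : ∀ s ∈ Icc (0:ℝ) 1, |h s| ≤ C)
    (ki : IntervalIntegrable k volume 0 1) (kC : ∀ s ∈ Icc (0:ℝ) 1, |k s| ≤ C')
    (hk : ∀ s ∈ Icc (0:ℝ) 1, h s ≤ k s)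
    {r : ℝ} (hr : r ∈ Icc (0:ℝ) 1) : Tf D α h r ≤ Tf D α k r := by
  apply intervalIntegral.integral_mono_on hr.2
  · exact ii_of_cont (Q_cont D α hα hi hC) hr (by simp)
  · exact ii_of_cont (Q_cont D α hα ki kC) hr (by simp)
  · intro x hx
    have hx' : x ∈ Icc (0:ℝ) 1 := ⟨hr.1.trans hx.1, hx.2⟩
    exact div_le_div_of_nonneg_right (H_mono D α hi ki hk hx') (p_nonneg D α hx'.1)

lemma T_nonneg {h : ℝ → ℝ} (h0 : ∀ s ∈ Icc (0:ℝ) 1, 0 ≤ h s) {r : ℝ} (hr : r ∈ Icc (0:ℝ) 1) :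
    0 ≤ Tf D α h r := by
  apply intervalIntegral.integral_nonneg hr.2
  intro x hx
  exact Q_nonneg D α h0 ⟨hr.1.trans hx.1, hx.2⟩

/-- derivative sign gives antitone -/
lemma anti_of_deriv {w q : ℝ → ℝ} (hw : ∀ r ∈ Icc (0:ℝ) 1, HasDerivWithinAt w (-(q r)) (Icc 0 1) r)
    (hq : ∀ r ∈ Icc (0:ℝ) 1, 0 ≤ q r) : AntitoneOn w (Icc 0 1) := by
  have hd : ∀ r ∈ Ioo (0:ℝ) 1, HasDerivAt w (-(q r)) r := fun r hr =>
    (hw r (Ioo_subset_Icc_self hr)).hasDerivAt (Icc_mem_nhds hr.1 hr.2)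
  apply antitoneOn_of_deriv_nonpos (convex_Icc 0 1) (fun r hr => (hw r hr).continuousWithinAt)
  · rw [interior_Icc]
    exact fun r hr => (hd r hr).differentiableAt.differentiableWithinAt
  · rw [interior_Icc]
    intro r hr
    rw [(hd r hr).deriv]
    linarith [hq r (Ioo_subset_Icc_self hr)]

lemma T_anti (hα : 0 < α) {h : ℝ → ℝ} {C : ℝ} (hi : IntervalIntegrable h volume 0 1)
    (hC : ∀ s ∈ Icc (0:ℝ) 1, |h s| ≤ C) (h0 : ∀ s ∈ Icc (0:ℝ) 1, 0 ≤ h s) :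
    AntitoneOn (Tf D α h) (Icc 0 1) :=
  anti_of_deriv (fun _ hr => T_deriv D α hα hi hC hr) (fun _ hr => Q_nonneg D α h0 hr)

/-- source term -/
noncomputable def src (l : ℝ) (g : ℝ → ℝ) (s : ℝ) : ℝ := l * D.psi s * D.f (g s)

lemma src_cont (l : ℝ) {g : ℝ → ℝ} (hg : ContinuousOn g (Icc 0 1))
    (g0 : ∀ r ∈ Icc (0:ℝ) 1, 0 ≤ g r) : ContinuousOn (src D l g) (Icc 0 1) :=
  (continuousOn_const.mul (psi_cont D)).mul (D.f_smooth.continuousOn.comp hg g0)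

lemma src_nonneg {l : ℝ} (hl : 0 < l) {g : ℝ → ℝ}
    (g0 : ∀ r ∈ Icc (0:ℝ) 1, 0 ≤ g r) {r : ℝ} (hr : r ∈ Icc (0:ℝ) 1) : 0 ≤ src D l g r :=
  mul_nonneg (mul_nonneg hl.le (D.psi_nonneg r hr)) (D.f_pos _ (g0 r hr)).le

lemma src_anti {l : ℝ} (hl : 0 < l) {g : ℝ → ℝ} (hg : AntitoneOn g (Icc 0 1))
    (g0 : ∀ r ∈ Icc (0:ℝ) 1, 0 ≤ g r) : AntitoneOn (src D l g) (Icc 0 1) := by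
  intro a ha b hb hab
  have h1 := D.psi_anti ha hb hab
  have h2 := D.f_mono (g0 b hb) (g0 a ha) (hg ha hb hab)
  have h3 := D.psi_nonneg a ha
  have h4 := (D.f_pos _ (g0 b hb)).le
  unfold src
  gcongr

lemma src_mono {l : ℝ} (hl : 0 < l) {g k : ℝ → ℝ} (g0 : ∀ r ∈ Icc (0:ℝ) 1, 0 ≤ g r)
    (hgk : ∀ r ∈ Icc (0:ℝ) 1, g r ≤ k r) {r : ℝ} (hr : r ∈ Icc (0:ℝ) 1) :
    src D l g r ≤ src D l k r := by
  apply mul_le_mul_of_nonneg_left _ (mul_nonneg hl.le (D.psi_nonneg r hr))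
  exact D.f_mono (g0 r hr) ((g0 r hr).trans (hgk r hr)) (hgk r hr)

lemma anti_ii {h : ℝ → ℝ} (hh : AntitoneOn h (Icc 0 1)) : IntervalIntegrable h volume 0 1 := by
  apply AntitoneOn.intervalIntegrable
  rwa [uIcc_of_le zero_le_one]

lemma src_bd {l : ℝ} (hl : 0 < l) {g : ℝ → ℝ} (hg : AntitoneOn g (Icc 0 1))
    (g0 : ∀ r ∈ Icc (0:ℝ) 1, 0 ≤ g r) : ∀ s ∈ Icc (0:ℝ) 1, |src D l g s| ≤ src D l g 0 := by
  intro s hs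
  rw [abs_of_nonneg (src_nonneg D hl g0 hs)]
  exact src_anti D hl hg g0 (by simp) hs hs.1

lemma exists_fixed (hα : 0 < α) {l : ℝ} (hl : 0 < l) {w : ℝ → ℝ} (hw : AntitoneOn w (Icc 0 1))
    (w0 : ∀ r ∈ Icc (0:ℝ) 1, 0 ≤ w r) (hT : ∀ r ∈ Icc (0:ℝ) 1, Tf D α (src D l w) r ≤ w r) :
    ∃ v : ℝ → ℝ, AntitoneOn v (Icc 0 1) ∧ (∀ r ∈ Icc (0:ℝ) 1, 0 ≤ v r) ∧
      (∀ r ∈ Icc (0:ℝ) 1, v r ≤ w r) ∧ ∀ r ∈ Icc (0:ℝ) 1, v r = Tf D α (src D l v) r := by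
  let S : Set (ℝ → ℝ) := {g | AntitoneOn g (Icc 0 1) ∧ (∀ r ∈ Icc (0:ℝ) 1, 0 ≤ g r) ∧
    ∀ r ∈ Icc (0:ℝ) 1, Tf D α (src D l g) r ≤ g r}
  have hwS : w ∈ S := ⟨hw, w0, hT⟩
  let v : ℝ → ℝ := fun r => sInf ((fun g : ℝ → ℝ => g r) '' S)
  have hne : ∀ r, ((fun g : ℝ → ℝ => g r) '' S).Nonempty := fun r => ⟨w r, w, hwS, rfl⟩
  have hle : ∀ g ∈ S, ∀ r ∈ Icc (0:ℝ) 1, v r ≤ g r := by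
    intro g hg r hr
    apply csInf_le
    · refine ⟨0, ?_⟩
      rintro _ ⟨k, hk, rfl⟩
      exact hk.2.1 r hr
    · exact ⟨g, hg, rfl⟩
  have hge : ∀ r, ∀ c, (∀ g ∈ S, c ≤ g r) → c ≤ v r := by
    intro r c hc
    apply le_csInf (hne r)
    rintro _ ⟨k, hk, rfl⟩
    exact hc k hk
  have v0 : ∀ r ∈ Icc (0:ℝ) 1, 0 ≤ v r := fun r hr => hge r 0 (fun g hg => hg.2.1 r hr)
  have va : AntitoneOn v (Icc 0 1) := by
    intro a ha b hb hab
    exact hge a _ (fun g hg => (hle g hg b hb).trans (hg.1 ha hb hab))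
  have tmono : ∀ g k : ℝ → ℝ, AntitoneOn g (Icc 0 1) → (∀ r ∈ Icc (0:ℝ) 1, 0 ≤ g r) →
      AntitoneOn k (Icc 0 1) → (∀ r ∈ Icc (0:ℝ) 1, g r ≤ k r) →
      ∀ r ∈ Icc (0:ℝ) 1, Tf D α (src D l g) r ≤ Tf D α (src D l k) r := by
    intro g k ga g0 ka hgk r hr
    have k0 : ∀ r ∈ Icc (0:ℝ) 1, 0 ≤ k r := fun r hr => (g0 r hr).trans (hgk r hr)
    exact T_mono D α hα (anti_ii (src_anti D hl ga g0)) (src_bd D hl ga g0)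
      (anti_ii (src_anti D hl ka k0)) (src_bd D hl ka k0)
      (fun s hs => src_mono D hl g0 hgk hs) hr
  have hTv : ∀ r ∈ Icc (0:ℝ) 1, Tf D α (src D l v) r ≤ v r := by
    intro r hr
    exact hge r _ (fun g hg => (tmono v g va v0 hg.1 (hle g hg) r hr).trans (hg.2.2 r hr))
  have Ta := T_anti D α hα (anti_ii (src_anti D hl va v0)) (src_bd D hl va v0)
    (fun s hs => src_nonneg D hl v0 hs)
  have T0 : ∀ r ∈ Icc (0:ℝ) 1, 0 ≤ Tf D α (src D l v) r := fun r hr =>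
    T_nonneg D α (fun s hs => src_nonneg D hl v0 hs) hr
  have hTS : Tf D α (src D l v) ∈ S := ⟨Ta, T0, fun r hr => tmono _ _ Ta T0 va hTv r hr⟩
  exact ⟨v, va, v0, hle w hwS, fun r hr => le_antisymm (hle _ hTS r hr) (hTv r hr)⟩

lemma H_pos {h : ℝ → ℝ} (hc : ContinuousOn h (Icc 0 1)) (h0 : ∀ s ∈ Icc (0:ℝ) 1, 0 ≤ h s)
    (h00 : 0 < h 0) {t : ℝ} (ht : t ∈ Ioc (0:ℝ) 1) : 0 < Hf D α h t := by
  have hsub : Icc (0:ℝ) t ⊆ Icc 0 1 := Icc_subset_Icc le_rfl ht.2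
  apply intervalIntegral.integral_pos ht.1
  · exact ((p_cont D α).mul hc).mono hsub
  · intro x hx
    exact mul_nonneg (p_nonneg D α hx.1.le) (h0 x (hsub ⟨hx.1.le, hx.2⟩))
  · have h1 : ∀ᶠ x in 𝓝[Icc 0 1] (0:ℝ), 0 < h x :=
      (hc 0 (by simp)).eventually (lt_mem_nhds h00)
    have h2 : 𝓝[Ioc 0 t] (0:ℝ) ≤ 𝓝[Icc 0 1] (0:ℝ) :=
      nhdsWithin_mono _ (Ioc_subset_Icc_self.trans hsub)
    have : (𝓝[Ioc 0 t] (0:ℝ)).NeBot := by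
      rw [nhdsWithin_Ioc_eq_nhdsGT ht.1]; infer_instance
    obtain ⟨x, hx, hx'⟩ := ((h1.filter_mono h2).and self_mem_nhdsWithin).exists
    exact ⟨x, Ioc_subset_Icc_self hx', mul_pos (p_pos D α hx'.1) hx⟩

lemma Q_deriv {h : ℝ → ℝ} (hc : ContinuousOn h (Icc 0 1)) {r : ℝ} (hr : r ∈ Ioo (0:ℝ) 1) :
    HasDerivAt (Qf D α h) (h r - Qf D α h r * (1 / r + α * r * D.phi r)) r := by
  have h1 : HasDerivAt (Hf D α h) (pW D α r * h r) r := ftc_open ((p_cont D α).mul hc) hr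
  have hp := (p_pos D α hr.1).ne'
  have h2 := h1.div (p_deriv D α hr) hp
  have h3 : h r - Qf D α h r * (1 / r + α * r * D.phi r) =
    (pW D α r * h r * pW D α r - Hf D α h r * (pW D α r * (1 / r + α * r * D.phi r))) /
      pW D α r ^ 2 := by
    unfold Qf
    generalize (1 / r + α * r * D.phi r) = c
    field_simp
  rw [h3]; exact h2

lemma bd_of_cont {h : ℝ → ℝ} (hc : ContinuousOn h (Icc 0 1)) :
    ∃ C, ∀ s ∈ Icc (0:ℝ) 1, |h s| ≤ C := isCompact_Icc.exists_bound_of_continuousOn hc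

lemma fixed_sol (hα : 0 < α) {l : ℝ} (hl : 0 < l) {v : ℝ → ℝ} (va : AntitoneOn v (Icc 0 1))
    (v0 : ∀ r ∈ Icc (0:ℝ) 1, 0 ≤ v r)
    (hv : ∀ r ∈ Icc (0:ℝ) 1, v r = Tf D α (src D l v) r) : IsSolution D α l v := by
  have hd : ∀ r ∈ Icc (0:ℝ) 1, HasDerivWithinAt v (-(Qf D α (src D l v) r)) (Icc 0 1) r :=
    fun r hr => (T_deriv D α hα (anti_ii (src_anti D hl va v0)) (src_bd D hl va v0) hr).congr
      hv (hv r hr)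
  have vc : ContinuousOn v (Icc 0 1) := fun r hr => (hd r hr).continuousWithinAt
  have sc := src_cont D l vc v0
  have qc : ContinuousOn (Qf D α (src D l v)) (Icc 0 1) :=
    Q_cont D α hα (anti_ii (src_anti D hl va v0)) (src_bd D hl va v0)
  have hdw : ∀ r ∈ Icc (0:ℝ) 1, derivWithin v (Icc 0 1) r = -(Qf D α (src D l v) r) :=
    fun r hr => (hd r hr).derivWithin (uniqueDiffOn_Icc zero_lt_one r hr)
  have hda : ∀ r ∈ Ioo (0:ℝ) 1, HasDerivAt v (-(Qf D α (src D l v) r)) r :=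
    fun r hr => (hd r (Ioo_subset_Icc_self hr)).hasDerivAt (Icc_mem_nhds hr.1 hr.2)
  have hqd := fun r (hr : r ∈ Ioo (0:ℝ) 1) => Q_deriv D α sc hr
  refine ⟨?_, ?_, ?_, ?_, ?_, ?_⟩
  · rw [contDiffOn_one_iff_derivWithin (uniqueDiffOn_Icc zero_lt_one)]
    exact ⟨fun r hr => (hd r hr).differentiableWithinAt, qc.neg.congr hdw⟩
  · have : (2 : WithTop ℕ∞) = 1 + 1 := by norm_num
    rw [this, contDiffOn_succ_iff_deriv_of_isOpen isOpen_Ioo]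
    refine ⟨fun r hr => (hda r hr).differentiableAt.differentiableWithinAt, by simp, ?_⟩
    have h1 : ContDiffOn ℝ 1 (Qf D α (src D l v)) (Ioo 0 1) := by
      have : (1 : WithTop ℕ∞) = 0 + 1 := by norm_num
      rw [this, contDiffOn_succ_iff_deriv_of_isOpen isOpen_Ioo]
      refine ⟨fun r hr => (hqd r hr).differentiableAt.differentiableWithinAt, by simp, ?_⟩
      rw [contDiffOn_zero]
      refine ContinuousOn.congr ?_ (fun r hr => (hqd r hr).deriv)
      have e : Ioo (0:ℝ) 1 ⊆ Icc 0 1 := Ioo_subset_Icc_self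
      refine (sc.mono e).sub ((qc.mono e).mul (ContinuousOn.add ?_ ?_))
      · exact continuousOn_const.div continuousOn_id (fun x hx => hx.1.ne')
      · exact (continuousOn_const.mul continuousOn_id).mul ((phi_cont D).mono e)
    exact h1.neg.congr (fun r hr => (hda r hr).deriv)
  · intro r hr
    have hr' : r ∈ Icc (0:ℝ) 1 := Ico_subset_Icc_self hr
    rw [hv r hr']
    apply intervalIntegral.intervalIntegral_pos_of_pos_on _ _ hr.2
    · exact ii_of_cont qc hr' (by simp)
    · intro x hx
      have hx0 : 0 < x := hr.1.trans_lt hx.1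
      apply div_pos _ (p_pos D α hx0)
      apply H_pos D α sc (fun s hs => src_nonneg D hl v0 hs) _ ⟨hx0, hx.2.le⟩
      rw [src, D.psi_zero]
      have := D.f_pos _ (v0 0 (by simp))
      positivity
  · rw [hdw 0 (by simp), Q_zero, neg_zero]
  · rw [hv 1 (by simp), Tf, intervalIntegral.integral_same]
  · intro r hr
    have hr' := Ioo_subset_Icc_self hr
    have h1 : HasDerivAt (derivWithin v (Icc 0 1))
        (-(src D l v r - Qf D α (src D l v) r * (1 / r + α * r * D.phi r))) r := by
      apply (hqd r hr).neg.congr_of_eventuallyEq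
      filter_upwards [Icc_mem_nhds hr.1 hr.2] with x hx using hdw x hx
    rw [(h1.hasDerivWithinAt).derivWithin (isOpen_Ioo.uniqueDiffOn r hr), hdw r hr']
    simp only [src]
    ring

lemma sol_nonneg {l : ℝ} {w : ℝ → ℝ} (hw : IsSolution D α l w) :
    ∀ r ∈ Icc (0:ℝ) 1, 0 ≤ w r := by
  intro r hr
  rcases hr.2.eq_or_lt with h | h
  · rw [h, hw.2.2.2.2.1]
  · exact (hw.2.2.1 r ⟨hr.1, h⟩).le

lemma sol_deriv {l : ℝ} {w : ℝ → ℝ} (hw : IsSolution D α l w) :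
    ∀ r ∈ Icc (0:ℝ) 1, HasDerivWithinAt w (-(Qf D α (src D l w) r)) (Icc 0 1) r := by
  have w0 := sol_nonneg D α hw
  obtain ⟨h1, h2, h3, h4, h5, h6⟩ := hw
  have wc := h1.continuousOn
  have sc := src_cont D l wc w0
  rw [contDiffOn_one_iff_derivWithin (uniqueDiffOn_Icc zero_lt_one)] at h1
  have h22 : (2 : WithTop ℕ∞) = 1 + 1 := by norm_num
  rw [h22, contDiffOn_succ_iff_deriv_of_isOpen isOpen_Ioo] at h2
  have hdd : ∀ r ∈ Ioo (0:ℝ) 1, HasDerivAt (derivWithin w (Icc 0 1))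
      (derivWithin (derivWithin w (Icc 0 1)) (Ioo 0 1) r) r := by
    intro r hr
    have a1 : DifferentiableOn ℝ (deriv w) (Ioo 0 1) := h2.2.2.differentiableOn (by simp)
    have a2 : DifferentiableOn ℝ (derivWithin w (Icc 0 1)) (Ioo 0 1) :=
      a1.congr (fun x hx => derivWithin_of_mem_nhds (Icc_mem_nhds hx.1 hx.2))
    exact (a2 r hr).hasDerivWithinAt.hasDerivAt (isOpen_Ioo.mem_nhds hr)
  have hg : ∀ r ∈ Ioo (0:ℝ) 1, HasDerivAt (fun t => pW D α t * derivWithin w (Icc 0 1) t)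
      (-(pW D α r * src D l w r)) r := by
    intro r hr
    have := (p_deriv D α hr).mul (hdd r hr)
    have e : -(pW D α r * src D l w r) = pW D α r * (1 / r + α * r * D.phi r) *
        derivWithin w (Icc 0 1) r +
        pW D α r * derivWithin (derivWithin w (Icc 0 1)) (Ioo 0 1) r := by
      rw [src, ← h6 r hr]; ring
    rw [e]; exact this
  have key : ∀ r ∈ Icc (0:ℝ) 1, derivWithin w (Icc 0 1) r = -(Qf D α (src D l w) r) := by
    intro r hr
    rcases hr.1.eq_or_lt with h0 | h0
    · rw [← h0, h4, Q_zero, neg_zero]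
    · have hsub : Icc (0:ℝ) r ⊆ Icc 0 1 := Icc_subset_Icc le_rfl hr.2
      have e := intervalIntegral.integral_eq_sub_of_hasDerivAt_of_le hr.1
        (((p_cont D α).mul h1.2).mono hsub)
        (fun x hx => hg x ⟨hx.1, hx.2.trans_le hr.2⟩)
        (ii_of_cont ((p_cont D α).mul sc).neg (by simp) hr)
      rw [intervalIntegral.integral_neg] at e
      have hp := (p_pos D α h0).ne'
      have e' : -(Hf D α (src D l w) r) = pW D α r * derivWithin w (Icc 0 1) r -
          pW D α 0 * derivWithin w (Icc 0 1) 0 := e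
      rw [h4] at e'
      rw [Qf, ← neg_div, e']
      field_simp
      ring
  intro r hr
  rw [← key r hr]
  exact (h1.1 r hr).hasDerivWithinAt

lemma sol_int (hα : 0 < α) {l : ℝ} {w : ℝ → ℝ} (hw : IsSolution D α l w) :
    ∀ r ∈ Icc (0:ℝ) 1, w r = Tf D α (src D l w) r := by
  intro r hr
  have hd := sol_deriv D α hw
  have wc : ContinuousOn w (Icc 0 1) := fun r hr => (hd r hr).continuousWithinAt
  have sc := src_cont D l wc (sol_nonneg D α hw)
  obtain ⟨C, hC⟩ := bd_of_cont sc
  have qc := Q_cont D α hα (ii_of_cont sc (by simp) (by simp)) hC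
  have e := intervalIntegral.integral_eq_sub_of_hasDerivAt_of_le hr.2
    (wc.mono (Icc_subset_Icc hr.1 le_rfl))
    (fun x hx => (hd x ⟨hr.1.trans hx.1.le, hx.2.le⟩).hasDerivAt
      (Icc_mem_nhds (hr.1.trans_lt hx.1) hx.2))
    (ii_of_cont qc.neg hr (by simp))
  rw [intervalIntegral.integral_neg, hw.2.2.2.2.1] at e
  unfold Tf; linarith

lemma minimal_le (hα : 0 < α) {l l' : ℝ} (hl : 0 < l) (hll : l < l') {u w : ℝ → ℝ}
    (hmin : ∀ v, IsSolution D α l v → ∀ r ∈ Icc (0:ℝ) 1, u r ≤ v r)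
    (hw : IsSolution D α l' w) : ∀ r ∈ Icc (0:ℝ) 1, u r ≤ w r := by
  have w0 := sol_nonneg D α hw
  have hl' := hl.trans hll
  have wa : AntitoneOn w (Icc 0 1) := anti_of_deriv (sol_deriv D α hw)
    (fun r hr => Q_nonneg D α (fun s hs => src_nonneg D hl' w0 hs) hr)
  obtain ⟨v, va, v0, vw, hv⟩ := exists_fixed D α hα hl wa w0 (by
    intro r hr
    rw [sol_int D α hα hw r hr]
    have := T_mono D α hα (anti_ii (src_anti D hl wa w0)) (src_bd D hl wa w0)
      (anti_ii (src_anti D hl' wa w0)) (src_bd D hl' wa w0) (fun s hs => by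
        apply mul_le_mul_of_nonneg_right _ (D.f_pos _ (w0 s hs)).le
        exact mul_le_mul_of_nonneg_right hll.le (D.psi_nonneg s hs)) hr
    exact this)
  exact fun r hr => (hmin v (fixed_sol D α hα hl va v0 hv) r hr).trans (vw r hr)

lemma T_sub (hα : 0 < α) {h k : ℝ → ℝ} (hc : ContinuousOn h (Icc 0 1))
    (kc : ContinuousOn k (Icc 0 1)) {r : ℝ} (hr : r ∈ Icc (0:ℝ) 1) :
    Tf D α (fun s => h s - k s) r = Tf D α h r - Tf D α k r := by
  obtain ⟨C, hC⟩ := bd_of_cont hc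
  obtain ⟨C', kC⟩ := bd_of_cont kc
  have hi := ii_of_cont hc (a := 0) (b := 1) (by simp) (by simp)
  have ki := ii_of_cont kc (a := 0) (b := 1) (by simp) (by simp)
  have h1 : (1:ℝ) ∈ Icc (0:ℝ) 1 := by simp
  unfold Tf
  rw [← intervalIntegral.integral_sub (ii_of_cont (Q_cont D α hα hi hC) hr h1)
    (ii_of_cont (Q_cont D α hα ki kC) hr h1)]
  apply intervalIntegral.integral_congr
  intro t ht
  have ht' := uIcc_subset_Icc hr h1 ht
  simp only [Qf, Hf]
  rw [← sub_div, ← intervalIntegral.integral_sub (ii_sub (ph_ii D α hi) (by simp) ht')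
    (ii_sub (ph_ii D α ki) (by simp) ht')]
  congr 1
  apply intervalIntegral.integral_congr
  intro s _
  simp only
  ring

/-- Picone / Jacobi inequality -/
lemma picone (hα : 0 < α) {k V η : ℝ → ℝ} (kc : ContinuousOn k (Icc 0 1))
    (k0 : ∀ s ∈ Icc (0:ℝ) 1, 0 ≤ k s) (k00 : 0 < k 0)
    (hV : ContinuousOn V (Icc 0 1))
    (hkV : ∀ r ∈ Ioo (0:ℝ) 1, V r * Tf D α k r ≤ k r)
    (hη : ContDiff ℝ 1 η) (hη1 : η 1 = 0) :
    0 ≤ ∫ r in (0:ℝ)..1, (pW D α r * (deriv η r) ^ 2 - pW D α r * V r * (η r) ^ 2) := by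
  obtain ⟨C, hC⟩ := bd_of_cont kc
  have ki := ii_of_cont kc (a := 0) (b := 1) (by simp) (by simp)
  have qc := Q_cont D α hα ki hC
  have qpos : ∀ t ∈ Ioc (0:ℝ) 1, 0 < Qf D α k t := fun t ht =>
    div_pos (H_pos D α kc k0 k00 ht) (p_pos D α ht.1)
  have zd : ∀ r ∈ Icc (0:ℝ) 1, HasDerivWithinAt (Tf D α k) (-(Qf D α k r)) (Icc 0 1) r :=
    fun r hr => T_deriv D α hα ki hC hr
  have zc : ContinuousOn (Tf D α k) (Icc 0 1) := fun r hr => (zd r hr).continuousWithinAt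
  have zpos : ∀ r ∈ Ico (0:ℝ) 1, 0 < Tf D α k r := by
    intro r hr
    apply intervalIntegral.intervalIntegral_pos_of_pos_on _ _ hr.2
    · exact ii_of_cont qc (Ico_subset_Icc_self hr) (by simp)
    · exact fun x hx => qpos x ⟨hr.1.trans_lt hx.1, hx.2.le⟩
  have z1 : Tf D α k 1 = 0 := by rw [Tf, intervalIntegral.integral_same]
  have hsub : Icc (1/2:ℝ) 1 ⊆ Icc 0 1 := Icc_subset_Icc (by norm_num) le_rfl
  obtain ⟨c, hc0, hc⟩ : ∃ c > 0, ∀ t ∈ Icc (1/2:ℝ) 1, c ≤ Qf D α k t := by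
    obtain ⟨t, ht, hmin⟩ := isCompact_Icc.exists_isMinOn (s := Icc (1/2:ℝ) 1)
      (nonempty_Icc.2 (by norm_num)) (qc.mono hsub)
    exact ⟨_, qpos t ⟨by linarith [ht.1], ht.2⟩, fun x hx => hmin hx⟩
  have zlow : ∀ r ∈ Icc (1/2:ℝ) 1, c * (1 - r) ≤ Tf D α k r := by
    intro r hr
    have := intervalIntegral.integral_mono_on hr.2 (f := fun _ => c) (g := Qf D α k) (μ := volume)
      intervalIntegrable_const (ii_of_cont qc (hsub hr) (by simp))
      (fun x hx => hc x ⟨hr.1.trans hx.1, hx.2⟩)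
    rw [intervalIntegral.integral_const, smul_eq_mul] at this
    unfold Tf; linarith
  have dηc : Continuous (deriv η) := hη.continuous_deriv le_rfl
  have ηd : ∀ r, HasDerivAt η (deriv η r) r := fun r =>
    ((hη.differentiable (by simp)) r).hasDerivAt
  obtain ⟨A, hA⟩ := bd_of_cont (dηc.continuousOn (s := Icc 0 1))
  have hA0 : 0 ≤ A := (abs_nonneg _).trans (hA 0 (by simp))
  have ηb : ∀ r ∈ Icc (0:ℝ) 1, |η r| ≤ A * (1 - r) := by
    intro r hr
    have := (convex_Icc (0:ℝ) 1).norm_image_sub_le_of_norm_hasDerivWithin_le (f := η)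
      (fun x _ => (ηd x).hasDerivWithinAt) hA (x := 1) (y := r) (by simp) hr
    rw [hη1, sub_zero, Real.norm_eq_abs, Real.norm_eq_abs, abs_sub_comm,
      abs_of_nonneg (by linarith [hr.2] : (0:ℝ) ≤ 1 - r)] at this
    exact this
  have Hc := H_cont D α ki
  obtain ⟨N, hN⟩ := bd_of_cont Hc
  have hN0 : 0 ≤ N := (abs_nonneg _).trans (hN 0 (by simp))
  set B : ℝ → ℝ := fun r => -(Hf D α k r) * η r ^ 2 / Tf D α k r with hB
  have B1 : B 1 = 0 := by simp [hB, hη1]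
  have B0 : B 0 = 0 := by simp [hB, Hf]
  have Bc : ContinuousOn B (Icc 0 1) := by
    intro r hr
    rcases hr.2.eq_or_lt with h | h
    · subst h
      rw [ContinuousWithinAt, B1]
      apply squeeze_zero_norm' (a := fun t => (N * A ^ 2 / c) * (1 - t))
      · have : ∀ᶠ t in 𝓝[Icc 0 1] (1:ℝ), t ∈ Ioi (1/2:ℝ) :=
          nhdsWithin_le_nhds (Ioi_mem_nhds (by norm_num))
        filter_upwards [self_mem_nhdsWithin, this] with t ht ht2
        rcases ht.2.eq_or_lt with h1 | h1
        · subst h1; simp [B1]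
        · have hz := zpos t ⟨ht.1, h1⟩
          have h1t : 0 < 1 - t := by linarith
          have hl := zlow t ⟨le_of_lt ht2, ht.2⟩
          have e1 : ‖B t‖ = |Hf D α k t| * |η t| ^ 2 / Tf D α k t := by
            rw [hB, Real.norm_eq_abs, abs_div, abs_mul, abs_neg, abs_pow, abs_of_pos hz]
          rw [e1]
          calc |Hf D α k t| * |η t| ^ 2 / Tf D α k t
              ≤ N * (A * (1 - t)) ^ 2 / (c * (1 - t)) := by
                gcongr
                · exact hN t ht
                · exact ηb t ht
            _ = (N * A ^ 2 / c) * (1 - t) := by field_simp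
      · have : Continuous (fun t : ℝ => (N * A ^ 2 / c) * (1 - t)) := by fun_prop
        simpa using (this.tendsto 1).mono_left nhdsWithin_le_nhds
    · exact ((Hc r hr).neg.mul ((hη.continuous.continuousWithinAt).pow 2)).div (zc r hr)
        (zpos r ⟨hr.1, h⟩).ne'
  have main := intervalIntegral.sub_le_integral_of_hasDeriv_right_of_le (zero_le_one' ℝ) Bc
    (g' := fun r => ((-(pW D α r * k r) * η r ^ 2 + -(Hf D α k r) * (2 * η r * deriv η r)) *
      Tf D α k r - (-(Hf D α k r) * η r ^ 2) * (-(Qf D α k r))) / (Tf D α k r) ^ 2)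
    (φ := fun r => pW D α r * (deriv η r) ^ 2 - pW D α r * V r * (η r) ^ 2)
    ?_ ?_ ?_
  · rw [B1, B0] at main; simpa using main
  · intro r hr
    have hr' := Ioo_subset_Icc_self hr
    have d1 : HasDerivAt (Hf D α k) (pW D α r * k r) r := ftc_open ((p_cont D α).mul kc) hr
    have d2 := (zd r hr').hasDerivAt (Icc_mem_nhds hr.1 hr.2)
    have d3 : HasDerivAt (fun r => η r ^ 2) (2 * η r * deriv η r) r := by
      have := (ηd r).pow 2
      have e : 2 * η r * deriv η r = ((2:ℕ):ℝ) * η r ^ (2 - 1) * deriv η r := by simp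
      rw [e]; exact this
    exact ((d1.neg.mul d3).div d2 (zpos r ⟨hr.1.le, hr.2⟩).ne').hasDerivWithinAt
  · apply ContinuousOn.integrableOn_Icc
    exact ((p_cont D α).mul (dηc.continuousOn.pow 2)).sub
      (((p_cont D α).mul hV).mul (hη.continuous.continuousOn.pow 2))
  · intro r hr
    have hz := zpos r ⟨hr.1.le, hr.2⟩
    have hp := p_pos D α hr.1
    have hk := hkV r hr
    simp only [Qf]
    generalize Tf D α k r = z at *
    generalize pW D α r = p at *
    generalize Hf D α k r = H at *
    generalize k r = kr at *
    generalize V r = v at *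
    generalize η r = e at *
    generalize deriv η r = e' at *
    have key : (p * e' ^ 2 - p * v * e ^ 2) - ((-(p * kr) * e ^ 2 + -H * (2 * e * e')) * z -
        (-H * e ^ 2) * (-(H / p))) / z ^ 2
        = p * e ^ 2 * (kr - v * z) / z + (p * e' + H * e / z) ^ 2 / p := by
      field_simp
      ring
    have k1 : 0 ≤ p * e ^ 2 * (kr - v * z) / z :=
      div_nonneg (mul_nonneg (by positivity) (by linarith)) hz.le
    have k2 : 0 ≤ (p * e' + H * e / z) ^ 2 / p := by positivity
    linarith

end GSS

open GSS in
/-- For `0 < λ < λ*(α)`, every minimal solution of `(P_{α,λ})`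
is semistable. -/
theorem minimal_solution_semistable (D : GelfandData) (α lam : ℝ)
    (hα : 0 < α) (hlam0 : 0 < lam) (hlam : lam < lamStar D α)
    (u : ℝ → ℝ) (hu : IsSolution D α lam u)
    (hmin : ∀ v, IsSolution D α lam v → ∀ r ∈ Icc (0:ℝ) 1, u r ≤ v r) :
    IsSemistable D α lam u := by
  intro η hη hη1
  obtain ⟨l', ⟨hl', w, hw⟩, hll⟩ := exists_lt_of_lt_csSup
    (⟨lam, hlam0, u, hu⟩ : (solvableSet D α).Nonempty) hlam
  have huw := minimal_le D α hα hlam0 hll hmin hw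
  have u0 := sol_nonneg D α hu
  have w0 := sol_nonneg D α hw
  have uc := hu.1.continuousOn
  have wc := hw.1.continuousOn
  have suc := src_cont D lam uc u0
  have swc := src_cont D l' wc w0
  have hT : ∀ r ∈ Icc (0:ℝ) 1, Tf D α (fun s => src D l' w s - src D lam u s) r = w r - u r := by
    intro r hr
    rw [T_sub D α hα swc suc hr, ← sol_int D α hα hw r hr, ← sol_int D α hα hu r hr]
  have hlow : ∀ r ∈ Icc (0:ℝ) 1, (l' - lam) * D.psi r * D.f (w r) +
      lam * D.psi r * (D.f (w r) - D.f (u r)) = src D l' w r - src D lam u r := by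
    intro r hr
    simp only [src]; ring
  have hfm : ∀ r ∈ Icc (0:ℝ) 1, 0 ≤ D.f (w r) - D.f (u r) := fun r hr =>
    sub_nonneg.2 (D.f_mono (u0 r hr) (w0 r hr) (huw r hr))
  have hll0 : 0 < l' - lam := sub_pos.2 hll
  have hf' := (contDiffOn_one_iff_derivWithin (uniqueDiffOn_Ici 0)).1 D.f_smooth
  have dfc : ContinuousOn (fun r => derivWithin D.f (Ici 0) (u r)) (Icc 0 1) :=
    hf'.2.comp uc u0
  have hVc : ContinuousOn (fun r => lam * D.psi r * derivWithin D.f (Ici 0) (u r)) (Icc 0 1) :=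
    (continuousOn_const.mul (psi_cont D)).mul dfc
  have P := picone D α hα (k := fun s => src D l' w s - src D lam u s)
    (V := fun r => lam * D.psi r * derivWithin D.f (Ici 0) (u r)) (η := η)
    (swc.sub suc) ?_ ?_ hVc ?_ hη hη1
  · have i1 : ContinuousOn (fun r => pW D α r * (deriv η r) ^ 2) (Icc 0 1) :=
      (p_cont D α).mul ((hη.continuous_deriv le_rfl).continuousOn.pow 2)
    have i2 : ContinuousOn (fun r => pW D α r * (lam * D.psi r * derivWithin D.f (Ici 0) (u r)) *
        (η r) ^ 2) (Icc 0 1) :=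
      ((p_cont D α).mul hVc).mul (hη.continuous.continuousOn.pow 2)
    rw [intervalIntegral.integral_sub (ii_of_cont i1 (by simp) (by simp))
      (ii_of_cont i2 (by simp) (by simp)), intervalIntegral.integral_of_le zero_le_one,
      intervalIntegral.integral_of_le zero_le_one, MeasureTheory.integral_Ioc_eq_integral_Ioo,
      MeasureTheory.integral_Ioc_eq_integral_Ioo] at P
    rw [← MeasureTheory.integral_const_mul]
    have e1 : (∫ r in Ioo (0:ℝ) 1, lam * (D.psi r * derivWithin D.f (Ici 0) (u r) * (η r) ^ 2 *
        muW D α r * r)) = ∫ r in Ioo (0:ℝ) 1, pW D α r *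
        (lam * D.psi r * derivWithin D.f (Ici 0) (u r)) * (η r) ^ 2 := by
      congr 1; ext r; simp only [pW]; ring
    have e2 : (∫ r in Ioo (0:ℝ) 1, (deriv η r) ^ 2 * muW D α r * r) =
        ∫ r in Ioo (0:ℝ) 1, pW D α r * (deriv η r) ^ 2 := by
      congr 1; ext r; simp only [pW]; ring
    rw [e1, e2]; linarith
  · intro s hs
    rw [← hlow s hs]
    have := D.psi_nonneg s hs
    have := (D.f_pos _ (w0 s hs)).le
    have := hfm s hs
    positivity
  · have hs : (0:ℝ) ∈ Icc (0:ℝ) 1 := by simp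
    rw [← hlow 0 hs, D.psi_zero]
    have := (D.f_pos _ (w0 0 hs))
    have := hfm 0 hs
    positivity
  · intro r hr
    have hs := Ioo_subset_Icc_self hr
    rw [hT r hs, ← hlow r hs]
    have a1 := D.psi_nonneg r hs
    have a2 := (D.f_pos _ (w0 r hs)).le
    have tangent : derivWithin D.f (Ici 0) (u r) * (w r - u r) ≤ D.f (w r) - D.f (u r) := by
      rcases (huw r hs).eq_or_lt with h | h
      · rw [h]; simp
      · have := D.f_convex.derivWithin_le_slope (u0 r hs) (w0 r hs) h (hf'.1 _ (u0 r hs))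
        rw [slope_def_field, le_div_iff₀ (sub_pos.2 h)] at this
        exact this
    have a3 : 0 ≤ (l' - lam) * D.psi r * D.f (w r) := by positivity
    have a4 := mul_le_mul_of_nonneg_left tangent (mul_nonneg hlam0.le a1)
    linarith
end

section
/- Suppose ū ∈ C²((0,1)) ∩ C¹([0,1]) satisfies ū > 0 on [0,1), ū'(0) = 0, ū(1) ≥ 0, and the differential inequality −ū''(r) − (1/r + α r φ(r)) ū'(r) ≥ λ ψ(r) f(ū(r)) for all r ∈ (0,1). Then problem (P_{α,λ}) admits a solution u with u(r) ≤ ū(r) for all r ∈ [0,1]; moreover u can be chosen minimal, i.e. u ≤ v pointwise for every solution v of (P_{α,λ}). -/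
open Set MeasureTheory Filter

noncomputable def cl (r : ℝ) : ℝ := max 0 (min r 1)

lemma cl_mem (r : ℝ) : cl r ∈ Icc (0:ℝ) 1 :=
  ⟨le_max_left _ _, max_le zero_le_one (min_le_right _ _)⟩

lemma cl_eq {r : ℝ} (h : r ∈ Icc (0:ℝ) 1) : cl r = r := by
  unfold cl; rw [min_eq_left h.2, max_eq_right h.1]

lemma cl_cont : Continuous cl := by unfold cl; fun_prop

lemma cl_mono : Monotone cl := fun a b h => max_le_max le_rfl (min_le_min h le_rfl)

noncomputable def Qf (p P F w : ℝ → ℝ) (s : ℝ) : ℝ :=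
  (p s)⁻¹ * ∫ t in (0:ℝ)..s, p t * P t * F (w t)

noncomputable def Tf (p P F w : ℝ → ℝ) (r : ℝ) : ℝ := ∫ s in (cl r)..1, Qf p P F w s

structure Su (p P F a : ℝ → ℝ) (B : ℝ) : Prop where
  pc : Continuous p
  p0 : p 0 = 0
  ppos : ∀ s, 0 < s → s ≤ 1 → 0 < p s
  pmono : MonotoneOn p (Icc 0 1)
  Pc : Continuous P
  P0 : ∀ t, 0 ≤ P t
  PB : ∀ t, P t ≤ B
  Pz : 0 < P 0
  Fm : Monotone F
  Fc : Continuous F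
  Fpos : ∀ t, 0 < F t
  pd : ∀ r ∈ Ioo (0:ℝ) 1, HasDerivAt p (p r * a r) r
  ac : ContinuousOn a (Ioo 0 1)

namespace Su

variable {p P F a : ℝ → ℝ} {B : ℝ}

lemma pnn (S : Su p P F a B) {s : ℝ} (h : s ∈ Icc (0:ℝ) 1) : 0 ≤ p s := by
  rcases h.1.eq_or_lt with h0 | h0
  · rw [← h0, S.p0]
  · exact (S.ppos s h0 h.2).le

lemma hint (S : Su p P F a B) {w : ℝ → ℝ} (hw : Antitone w) (x y : ℝ) :
    IntervalIntegrable (fun t => p t * P t * F (w t)) volume x y := by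
  have h1 : Antitone (fun t => F (w t)) := fun a b h => S.Fm (hw h)
  exact (h1.intervalIntegrable).continuousOn_mul (S.pc.mul S.Pc).continuousOn

lemma hnn (S : Su p P F a B) (w : ℝ → ℝ) {s : ℝ} (h : s ∈ Icc (0:ℝ) 1) :
    0 ≤ p s * P s * F (w s) :=
  mul_nonneg (mul_nonneg (S.pnn h) (S.P0 s)) (S.Fpos _).le

lemma Qnn (S : Su p P F a B) (w : ℝ → ℝ) {s : ℝ} (h : s ∈ Icc (0:ℝ) 1) :
    0 ≤ Qf p P F w s := by
  unfold Qf
  refine mul_nonneg (inv_nonneg.2 (S.pnn h)) ?_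
  exact intervalIntegral.integral_nonneg h.1 fun t ht => S.hnn w ⟨ht.1, ht.2.trans h.2⟩

lemma Qmono (S : Su p P F a B) {w v : ℝ → ℝ} (hw : Antitone w) (hv : Antitone v)
    (hwv : ∀ t, w t ≤ v t) {s : ℝ} (h : s ∈ Icc (0:ℝ) 1) :
    Qf p P F w s ≤ Qf p P F v s := by
  unfold Qf
  refine mul_le_mul_of_nonneg_left ?_ (inv_nonneg.2 (S.pnn h))
  refine intervalIntegral.integral_mono_on h.1 (S.hint hw _ _) (S.hint hv _ _) fun t ht => ?_
  exact mul_le_mul_of_nonneg_left (S.Fm (hwv t))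
    (mul_nonneg (S.pnn ⟨ht.1, ht.2.trans h.2⟩) (S.P0 t))

lemma Qbd (S : Su p P F a B) {w : ℝ → ℝ} (hw : Antitone w) {s : ℝ} (h : s ∈ Icc (0:ℝ) 1) :
    Qf p P F w s ≤ s * (B * F (w 0)) := by
  rcases h.1.eq_or_lt with h0 | h0
  · simp [← h0, Qf]
  · have hp := S.ppos s h0 h.2
    unfold Qf
    rw [inv_mul_le_iff₀ hp]
    have : ∫ t in (0:ℝ)..s, p t * P t * F (w t) ≤ ∫ t in (0:ℝ)..s, p s * B * F (w 0) := by
      refine intervalIntegral.integral_mono_on h.1 (S.hint hw _ _) (by simp) fun t ht => ?_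
      have ht1 : t ∈ Icc (0:ℝ) 1 := ⟨ht.1, ht.2.trans h.2⟩
      have h3 := S.pmono ht1 h ht.2
      have h4 : F (w t) ≤ F (w 0) := S.Fm (hw ht.1)
      have h5 := S.pnn ht1
      have h6 := S.P0 t
      have h7 := S.PB t
      have h8 := (S.Fpos (w t)).le
      have h9 : 0 ≤ B := h6.trans h7
      gcongr
    refine this.trans (le_of_eq ?_)
    simp
    ring

lemma Qcont (S : Su p P F a B) {w : ℝ → ℝ} (hw : Antitone w) :
    ContinuousOn (Qf p P F w) (Icc 0 1) := by
  intro s hs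
  rcases hs.1.eq_or_lt with h0 | h0
  · subst h0
    have e : Qf p P F w 0 = 0 := by simp [Qf]
    unfold ContinuousWithinAt
    rw [e]
    refine tendsto_of_tendsto_of_tendsto_of_le_of_le' tendsto_const_nhds
      (h := fun s => s * (B * F (w 0))) ?_ ?_ ?_
    · have : Continuous fun s : ℝ => s * (B * F (w 0)) := by fun_prop
      simpa using (this.tendsto 0).mono_left nhdsWithin_le_nhds
    · filter_upwards [self_mem_nhdsWithin] with x hx using S.Qnn w hx
    · filter_upwards [self_mem_nhdsWithin] with x hx using S.Qbd hw hx
  · refine ContinuousAt.continuousWithinAt ?_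
    unfold Qf
    refine ContinuousAt.mul (S.pc.continuousAt.inv₀ (S.ppos s h0 hs.2).ne') ?_
    exact (intervalIntegral.continuous_primitive (fun x y => S.hint hw x y) 0).continuousAt

lemma Qint (S : Su p P F a B) {w : ℝ → ℝ} (hw : Antitone w) {x y : ℝ} (hx : x ∈ Icc (0:ℝ) 1)
    (hy : y ∈ Icc (0:ℝ) 1) :
    IntervalIntegrable (Qf p P F w) volume x y :=
  ((S.Qcont hw).mono ((ordConnected_Icc).uIcc_subset hx hy)).intervalIntegrable

lemma one_mem : (1:ℝ) ∈ Icc (0:ℝ) 1 := by simp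

lemma Tnn (S : Su p P F a B) (w : ℝ → ℝ) (r : ℝ) : 0 ≤ Tf p P F w r :=
  intervalIntegral.integral_nonneg (cl_mem r).2 fun _ ht => S.Qnn w ⟨(cl_mem r).1.trans ht.1, ht.2⟩

lemma Tmono (S : Su p P F a B) {w v : ℝ → ℝ} (hw : Antitone w) (hv : Antitone v)
    (hwv : ∀ t, w t ≤ v t) (r : ℝ) : Tf p P F w r ≤ Tf p P F v r :=
  intervalIntegral.integral_mono_on (cl_mem r).2 (S.Qint hw (cl_mem r) one_mem)
    (S.Qint hv (cl_mem r) one_mem)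
    fun _ ht => S.Qmono hw hv hwv ⟨(cl_mem r).1.trans ht.1, ht.2⟩

lemma Tanti (S : Su p P F a B) {w : ℝ → ℝ} (hw : Antitone w) : Antitone (Tf p P F w) := by
  intro x y hxy
  unfold Tf
  rw [← intervalIntegral.integral_add_adjacent_intervals (S.Qint hw (cl_mem x) (cl_mem y))
    (S.Qint hw (cl_mem y) one_mem)]
  have : 0 ≤ ∫ s in (cl x)..(cl y), Qf p P F w s :=
    intervalIntegral.integral_nonneg (cl_mono hxy) fun t ht =>
      S.Qnn w ⟨(cl_mem x).1.trans ht.1, ht.2.trans (cl_mem y).2⟩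
  linarith

lemma Tderiv (S : Su p P F a B) {w : ℝ → ℝ} (hw : Antitone w) {r : ℝ} (hr : r ∈ Icc (0:ℝ) 1) :
    HasDerivWithinAt (Tf p P F w) (-Qf p P F w r) (Icc 0 1) r := by
  have hc : Continuous (fun s => Qf p P F w (cl s)) :=
    continuous_iff_continuousAt.2 fun s => by
      have := (S.Qcont hw).comp_continuous cl_cont cl_mem
      exact this.continuousAt
  have h := (intervalIntegral.integral_hasDerivAt_left
    (hc.intervalIntegrable r 1) (hc.stronglyMeasurableAtFilter _ _) hc.continuousAt)
  rw [cl_eq hr] at h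
  refine h.hasDerivWithinAt.congr_of_mem ?_ hr
  intro x hx
  unfold Tf
  rw [cl_eq hx]
  refine intervalIntegral.integral_congr fun t ht => ?_
  rw [cl_eq]
  exact (ordConnected_Icc).uIcc_subset hx one_mem ht

lemma exists_fix (S : Su p P F a B) {w₀ : ℝ → ℝ} (h0 : Antitone w₀)
    (h2 : ∀ r, Tf p P F w₀ r ≤ w₀ r) :
    ∃ u, Antitone u ∧ (∀ r, u r = Tf p P F u r) ∧
      ∀ w, Antitone w → (∀ r, Tf p P F w r ≤ w r) → ∀ r, u r ≤ w r := by
  set X : Set (ℝ → ℝ) := {w | Antitone w ∧ ∀ r, Tf p P F w r ≤ w r} with hX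
  have hne : X.Nonempty := ⟨w₀, h0, h2⟩
  let u : ℝ → ℝ := fun r => sInf ((fun w : ℝ → ℝ => w r) '' X)
  have hbdd : ∀ r, BddBelow ((fun w : ℝ → ℝ => w r) '' X) := by
    rintro r
    refine ⟨0, ?_⟩
    rintro _ ⟨w, hw, rfl⟩
    exact (S.Tnn w r).trans (hw.2 r)
  have hle : ∀ w ∈ X, ∀ r, u r ≤ w r := fun w hw r => csInf_le (hbdd r) ⟨w, hw, rfl⟩
  have hge : ∀ r c, (∀ w ∈ X, c ≤ w r) → c ≤ u r := by
    intro r c h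
    refine le_csInf (hne.image _) ?_
    rintro _ ⟨w, hw, rfl⟩
    exact h w hw
  have hu : Antitone u := fun x y hxy => hge _ _ fun w hw => (hle w hw y).trans (hw.1 hxy)
  have hTu : ∀ r, Tf p P F u r ≤ u r := fun r => hge _ _ fun w hw =>
    (S.Tmono hu hw.1 (hle w hw) r).trans (hw.2 r)
  have hmem : Tf p P F u ∈ X := ⟨S.Tanti hu, S.Tmono (S.Tanti hu) hu hTu⟩
  exact ⟨u, hu, fun r => le_antisymm (hle _ hmem r) (hTu r), fun w h1 h2 => hle w ⟨h1, h2⟩⟩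

lemma Qderiv (S : Su p P F a B) {w : ℝ → ℝ} (hw : Continuous w) {r : ℝ} (hr : r ∈ Ioo (0:ℝ) 1) :
    HasDerivAt (Qf p P F w) (P r * F (w r) - a r * Qf p P F w r) r := by
  have hc : Continuous (fun t => p t * P t * F (w t)) :=
    (S.pc.mul S.Pc).mul (S.Fc.comp hw)
  have hp := (S.ppos r hr.1 hr.2.le).ne'
  have h := ((S.pd r hr).inv hp).mul (hc.integral_hasStrictDerivAt 0 r).hasDerivAt
  refine h.congr_deriv ?_
  unfold Qf
  simp only [Pi.inv_apply]
  field_simp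
  ring

lemma Qpos (S : Su p P F a B) {w : ℝ → ℝ} (hw : Continuous w) {s : ℝ} (hs : 0 < s) (hs1 : s ≤ 1) :
    0 < Qf p P F w s := by
  have hc : Continuous (fun t => p t * P t * F (w t)) :=
    (S.pc.mul S.Pc).mul (S.Fc.comp hw)
  unfold Qf
  refine mul_pos (inv_pos.2 (S.ppos s hs hs1)) ?_
  have h1 : ∀ᶠ t in nhdsWithin (0:ℝ) (Ioi 0), 0 < P t :=
    (S.Pc.continuousAt.eventually (lt_mem_nhds S.Pz)).filter_mono nhdsWithin_le_nhds
  have h2 : ∀ᶠ t in nhdsWithin (0:ℝ) (Ioi 0), t ∈ Ioo 0 s := Ioo_mem_nhdsGT hs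
  obtain ⟨t, ht1, ht2⟩ := (h1.and h2).exists
  refine intervalIntegral.integral_pos hs hc.continuousOn
    (fun x hx => S.hnn w ⟨hx.1.le, hx.2.trans hs1⟩) ⟨t, ⟨ht2.1.le, ht2.2.le⟩, ?_⟩
  exact mul_pos (mul_pos (S.ppos t ht2.1 (ht2.2.le.trans hs1)) ht1) (S.Fpos _)

lemma fix_sol (S : Su p P F a B) {u : ℝ → ℝ} (hu : Antitone u) (hfix : ∀ r, u r = Tf p P F u r) :
    ContDiffOn ℝ 1 u (Icc 0 1) ∧ ContDiffOn ℝ 2 u (Ioo 0 1) ∧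
    (∀ r ∈ Ico (0:ℝ) 1, 0 < u r) ∧
    derivWithin u (Icc 0 1) 0 = 0 ∧ u 1 = 0 ∧
    ∀ r ∈ Ioo (0:ℝ) 1,
      -(derivWithin (derivWithin u (Icc 0 1)) (Ioo 0 1) r)
        - a r * derivWithin u (Icc 0 1) r = P r * F (u r) := by
  have hd : ∀ r ∈ Icc (0:ℝ) 1, HasDerivWithinAt u (-Qf p P F u r) (Icc 0 1) r := by
    intro r hr
    have := S.Tderiv hu hr
    rwa [← (funext hfix : u = Tf p P F u)] at this
  have hdw : ∀ r ∈ Icc (0:ℝ) 1, derivWithin u (Icc 0 1) r = -Qf p P F u r := fun r hr =>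
    (hd r hr).derivWithin (uniqueDiffOn_Icc zero_lt_one r hr)
  have hcl : ∀ r, u r = u (cl r) := by
    intro r
    rw [hfix r, hfix (cl r)]
    unfold Tf
    rw [cl_eq (cl_mem r)]
  have hcu : Continuous u := by
    have h : ContinuousOn u (Icc 0 1) := fun r hr => (hd r hr).continuousWithinAt
    have := h.comp_continuous cl_cont cl_mem
    rwa [← (funext hcl : u = u ∘ cl)] at this
  have hdI : ∀ r ∈ Ioo (0:ℝ) 1, HasDerivAt u (-Qf p P F u r) r := fun r hr =>
    (hd r (Ioo_subset_Icc_self hr)).hasDerivAt (Icc_mem_nhds hr.1 hr.2)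
  have hQd := fun r (hr : r ∈ Ioo (0:ℝ) 1) => S.Qderiv hcu hr
  refine ⟨?_, ?_, ?_, ?_, ?_, ?_⟩
  · rw [show (1 : WithTop ℕ∞) = 0 + 1 from (zero_add 1).symm,
      contDiffOn_succ_iff_derivWithin (uniqueDiffOn_Icc zero_lt_one)]
    refine ⟨fun r hr => (hd r hr).differentiableWithinAt, by simp, ?_⟩
    rw [contDiffOn_zero]
    exact (S.Qcont hu).neg.congr hdw
  · rw [show (2 : WithTop ℕ∞) = 1 + 1 from one_add_one_eq_two.symm,
      contDiffOn_succ_iff_deriv_of_isOpen isOpen_Ioo]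
    refine ⟨fun r hr => (hdI r hr).differentiableAt.differentiableWithinAt, by simp, ?_⟩
    have : ContDiffOn ℝ 1 (fun r => -Qf p P F u r) (Ioo 0 1) := by
      rw [show (1 : WithTop ℕ∞) = 0 + 1 from (zero_add 1).symm,
        contDiffOn_succ_iff_deriv_of_isOpen isOpen_Ioo]
      refine ⟨fun r hr => (hQd r hr).neg.differentiableAt.differentiableWithinAt, by simp, ?_⟩
      rw [contDiffOn_zero]
      have h : ContinuousOn (fun r => -(P r * F (u r) - a r * Qf p P F u r)) (Ioo 0 1) :=
        (((S.Pc.mul (S.Fc.comp hcu)).continuousOn).sub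
          (S.ac.mul ((S.Qcont hu).mono Ioo_subset_Icc_self))).neg
      exact h.congr fun r hr => (hQd r hr).neg.deriv
    exact this.congr fun r hr => (hdI r hr).deriv
  · intro r hr
    rw [hfix r]
    unfold Tf
    rw [cl_eq ⟨hr.1, hr.2.le⟩]
    refine intervalIntegral.integral_pos hr.2
      ((S.Qcont hu).mono (Icc_subset_Icc hr.1 le_rfl))
      (fun x hx => S.Qnn u ⟨hr.1.trans hx.1.le, hx.2⟩) ⟨1, ⟨hr.2.le, le_rfl⟩, ?_⟩
    exact S.Qpos hcu zero_lt_one le_rfl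
  · rw [hdw 0 (by simp)]; simp [Qf]
  · rw [hfix 1]; unfold Tf; rw [cl_eq one_mem]; simp
  · intro r hr
    rw [hdw r (Ioo_subset_Icc_self hr)]
    have h : derivWithin (derivWithin u (Icc 0 1)) (Ioo 0 1) r
        = -(P r * F (u r) - a r * Qf p P F u r) := by
      have := (hQd r hr).neg.hasDerivWithinAt (s := Ioo (0:ℝ) 1)
      have h2 := this.congr_of_mem (f₁ := derivWithin u (Icc 0 1))
        (fun x hx => hdw x (Ioo_subset_Icc_self hx)) hr
      exact h2.derivWithin (isOpen_Ioo.uniqueDiffWithinAt hr)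
    rw [h]; ring

lemma super (S : Su p P F a B) {v : ℝ → ℝ}
    (h1 : ContDiffOn ℝ 1 v (Icc 0 1)) (h2 : ContDiffOn ℝ 2 v (Ioo 0 1)) (hb : 0 ≤ v 1)
    (hineq : ∀ r ∈ Ioo (0:ℝ) 1,
      P r * F (v r) ≤
        -(derivWithin (derivWithin v (Icc 0 1)) (Ioo 0 1) r)
          - a r * derivWithin v (Icc 0 1) r) :
    Antitone (fun r => v (cl r)) ∧ ∀ r, Tf p P F (fun r => v (cl r)) r ≤ v (cl r) := by
  set v' := derivWithin v (Icc 0 1) with hv'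
  set w : ℝ → ℝ := fun r => v (cl r) with hw
  have hwc : Continuous w := h1.continuousOn.comp_continuous cl_cont cl_mem
  have hv'c : ContinuousOn v' (Icc 0 1) :=
    h1.continuousOn_derivWithin (uniqueDiffOn_Icc zero_lt_one) le_rfl
  have hdv : ∀ r ∈ Ioo (0:ℝ) 1, HasDerivAt v (v' r) r := fun r hr =>
    ((h1.differentiableOn one_ne_zero r (Ioo_subset_Icc_self hr)).hasDerivWithinAt).hasDerivAt
      (Icc_mem_nhds hr.1 hr.2)
  have hdv' : ∀ r ∈ Ioo (0:ℝ) 1, HasDerivAt v' (derivWithin v' (Ioo 0 1) r) r := by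
    intro r hr
    have h3 : DifferentiableOn ℝ (deriv v) (Ioo 0 1) := by
      rw [show (2 : WithTop ℕ∞) = 1 + 1 from one_add_one_eq_two.symm,
        contDiffOn_succ_iff_deriv_of_isOpen isOpen_Ioo] at h2
      exact h2.2.2.differentiableOn one_ne_zero
    have h4 : DifferentiableOn ℝ v' (Ioo 0 1) := h3.congr fun x hx => (hdv x hx).deriv.symm
    exact (h4 r hr).hasDerivWithinAt.hasDerivAt (isOpen_Ioo.mem_nhds hr)
  have hc : Continuous (fun t => p t * P t * F (w t)) :=
    (S.pc.mul S.Pc).mul (S.Fc.comp hwc)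
  have hI : ∀ r, HasDerivAt (fun s => ∫ t in (0:ℝ)..s, p t * P t * F (w t))
      (p r * P r * F (w r)) r := fun r => (hc.integral_hasStrictDerivAt 0 r).hasDerivAt
  have hIc : Continuous (fun s => ∫ t in (0:ℝ)..s, p t * P t * F (w t)) :=
    continuous_iff_continuousAt.2 fun r => (hI r).continuousAt
  have hA : AntitoneOn (fun s => p s * v' s + ∫ t in (0:ℝ)..s, p t * P t * F (w t))
      (Icc 0 1) := by
    refine antitoneOn_of_hasDerivWithinAt_nonpos (convex_Icc 0 1)
      ((S.pc.continuousOn.mul hv'c).add hIc.continuousOn)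
      (f' := fun r => (p r * a r * v' r + p r * derivWithin v' (Ioo 0 1) r)
        + p r * P r * F (w r)) ?_ ?_
    · intro r hr
      rw [interior_Icc] at hr
      exact (((S.pd r hr).mul (hdv' r hr)).add (hI r)).hasDerivWithinAt
    · intro r hr
      rw [interior_Icc] at hr
      have e : w r = v r := by simp only [hw]; rw [cl_eq (Ioo_subset_Icc_self hr)]
      have := mul_le_mul_of_nonneg_left (hineq r hr) (S.ppos r hr.1 hr.2.le).le
      rw [e]
      linarith
  have hvQ : ∀ s ∈ Ioo (0:ℝ) 1, v' s ≤ -Qf p P F w s := by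
    intro s hs
    have h3 := hA (left_mem_Icc.2 zero_le_one) (Ioo_subset_Icc_self hs) hs.1.le
    simp only [S.p0, zero_mul, intervalIntegral.integral_same, add_zero] at h3
    have hp := S.ppos s hs.1 hs.2.le
    unfold Qf
    rw [le_neg, inv_mul_le_iff₀ hp]
    linarith
  have hvA : AntitoneOn v (Icc 0 1) := by
    refine antitoneOn_of_hasDerivWithinAt_nonpos (convex_Icc 0 1) h1.continuousOn
      (f' := v') ?_ ?_
    · intro r hr
      rw [interior_Icc] at hr
      exact (hdv r hr).hasDerivWithinAt
    · intro r hr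
      rw [interior_Icc] at hr
      have := S.Qnn w (Ioo_subset_Icc_self hr)
      linarith [hvQ r hr]
  have hwA : Antitone w := fun x y hxy => hvA (cl_mem x) (cl_mem y) (cl_mono hxy)
  refine ⟨hwA, fun r => ?_⟩
  have hT : AntitoneOn (fun s => v s - Tf p P F w s) (Icc 0 1) := by
    refine antitoneOn_of_hasDerivWithinAt_nonpos (convex_Icc 0 1)
      (h1.continuousOn.sub fun r hr => (S.Tderiv hwA hr).continuousWithinAt)
      (f' := fun r => v' r - (-Qf p P F w r)) ?_ ?_
    · intro r hr
      rw [interior_Icc] at hr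
      exact ((hdv r hr).sub ((S.Tderiv hwA (Ioo_subset_Icc_self hr)).hasDerivAt
        (Icc_mem_nhds hr.1 hr.2))).hasDerivWithinAt
    · intro r hr
      rw [interior_Icc] at hr
      linarith [hvQ r hr]
  have h5 := hT (cl_mem r) one_mem (cl_mem r).2
  have e1 : Tf p P F w 1 = 0 := by unfold Tf; rw [cl_eq one_mem]; simp
  have e2 : Tf p P F w (cl r) = Tf p P F w r := by unfold Tf; rw [cl_eq (cl_mem r)]
  simp only [e1, e2] at h5
  linarith

end Su

lemma mkSu (D : GelfandData) (α lam : ℝ) (hα : 0 < α) (hlam : 0 < lam) :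
    Su (fun r => r * Real.exp (α * ∫ s in (0:ℝ)..r, s * D.phi (cl s)))
      (fun r => lam * D.psi (cl r)) (fun x => D.f (max 0 x))
      (fun r => 1 / r + α * r * D.phi r) lam := by
  obtain ⟨L, hL⟩ := D.phi_lip
  obtain ⟨L', hL'⟩ := D.psi_lip
  have hphi : Continuous fun s => D.phi (cl s) := hL.continuousOn.comp_continuous cl_cont cl_mem
  have hpsi : Continuous fun s => D.psi (cl s) := hL'.continuousOn.comp_continuous cl_cont cl_mem
  have hc : Continuous fun s => s * D.phi (cl s) := continuous_id.mul hphi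
  have hI : ∀ r, HasDerivAt (fun r => ∫ s in (0:ℝ)..r, s * D.phi (cl s)) (r * D.phi (cl r)) r :=
    fun r => (hc.integral_hasStrictDerivAt 0 r).hasDerivAt
  have hIc : Continuous (fun r => ∫ s in (0:ℝ)..r, s * D.phi (cl s)) :=
    continuous_iff_continuousAt.2 fun r => (hI r).continuousAt
  have h0 : cl 0 = 0 := cl_eq (by simp)
  refine ⟨by fun_prop, by simp, fun s hs _ => by positivity, ?_, by fun_prop, fun t => ?_,
    fun t => ?_, ?_, ?_, ?_, ?_, ?_, ?_⟩
  · intro x hx y hy hxy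
    have h3 : ∫ s in (0:ℝ)..x, s * D.phi (cl s) ≤ ∫ s in (0:ℝ)..y, s * D.phi (cl s) := by
      rw [← intervalIntegral.integral_add_adjacent_intervals (hc.intervalIntegrable 0 x)
        (hc.intervalIntegrable x y)]
      have : 0 ≤ ∫ s in x..y, s * D.phi (cl s) := intervalIntegral.integral_nonneg hxy
        fun t ht => mul_nonneg (hx.1.trans ht.1) (D.phi_nonneg _ (cl_mem t))
      linarith
    have := hx.1
    have := hy.1
    dsimp only
    gcongr
  · exact mul_nonneg hlam.le (D.psi_nonneg _ (cl_mem t))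
  · have := D.psi_anti (left_mem_Icc.2 zero_le_one) (cl_mem t) (cl_mem t).1
    rw [D.psi_zero] at this
    nlinarith
  · skip; rw [h0, D.psi_zero]; linarith
  · intro x y hxy
    exact D.f_mono (le_max_left 0 x) (le_max_left 0 y) (max_le_max le_rfl hxy)
  · exact D.f_smooth.continuousOn.comp_continuous (by fun_prop) fun x => le_max_left 0 x
  · exact fun t => D.f_pos _ (le_max_left 0 t)
  · intro r hr
    have h := (hasDerivAt_id r).mul (((hI r).const_mul α).exp)
    refine h.congr_deriv ?_
    rw [cl_eq (Ioo_subset_Icc_self hr)]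
    have := hr.1.ne'
    simp only [id]
    field_simp
  · have hp : ContinuousOn D.phi (Ioo 0 1) := hL.continuousOn.mono Ioo_subset_Icc_self
    have : ContinuousOn (fun r : ℝ => 1 / r) (Ioo 0 1) :=
      continuousOn_const.div continuousOn_id fun x hx => hx.1.ne'
    fun_prop

/-- If `(P_{α,λ})` has a positive classical super-solution `ū`, then
it has a solution `u ≤ ū`, which can moreover be chosen minimal. -/
theorem supersolution_gives_minimal_solution (D : GelfandData) (α lam : ℝ)
    (hα : 0 < α) (hlam : 0 < lam) (ub : ℝ → ℝ)
    (h1 : ContDiffOn ℝ 1 ub (Icc 0 1)) (h2 : ContDiffOn ℝ 2 ub (Ioo 0 1))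
    (hpos : ∀ r ∈ Ico (0:ℝ) 1, 0 < ub r)
    (hd0 : derivWithin ub (Icc 0 1) 0 = 0) (hb : 0 ≤ ub 1)
    (hineq : ∀ r ∈ Ioo (0:ℝ) 1,
      lam * D.psi r * D.f (ub r) ≤
        -(derivWithin (derivWithin ub (Icc 0 1)) (Ioo 0 1) r)
          - (1 / r + α * r * D.phi r) * derivWithin ub (Icc 0 1) r) :
    ∃ u, IsSolution D α lam u ∧ (∀ r ∈ Icc (0:ℝ) 1, u r ≤ ub r) ∧
      ∀ v, IsSolution D α lam v → ∀ r ∈ Icc (0:ℝ) 1, u r ≤ v r := by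
  have S := mkSu D α lam hα hlam
  have key : ∀ v : ℝ → ℝ, (∀ r ∈ Ico (0:ℝ) 1, 0 < v r) → ∀ r ∈ Ioo (0:ℝ) 1,
      lam * D.psi (cl r) * D.f (max 0 (v r)) = lam * D.psi r * D.f (v r) := by
    intro v hv r hr
    rw [cl_eq (Ioo_subset_Icc_self hr), max_eq_right (hv r ⟨hr.1.le, hr.2⟩).le]
  obtain ⟨hA, hT⟩ := S.super h1 h2 hb fun r hr => (key ub hpos r hr).trans_le (hineq r hr)
  obtain ⟨u, hu, hfix, hmin⟩ := S.exists_fix hA hT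
  obtain ⟨g1, g2, g3, g4, g5, g6⟩ := S.fix_sol hu hfix
  refine ⟨u, ⟨g1, g2, g3, g4, g5, fun r hr => (g6 r hr).trans (key u g3 r hr)⟩, ?_, ?_⟩
  · intro r hr
    have := hmin _ hA hT r
    rwa [cl_eq hr] at this
  · rintro v ⟨k1, k2, k3, k4, k5, k6⟩ r hr
    obtain ⟨hA', hT'⟩ := S.super k1 k2 k5.ge fun r hr =>
      (key v k3 r hr).trans_le (k6 r hr).ge
    have := hmin _ hA' hT' r
    rwa [cl_eq hr] at this
end

section
/- Suppose G̲ ∈ C²((0,√α)) ∩ C¹([0,√α]) is positive on [0,√α], with G̲'(0) = 0, G̲(√α) ≤ K, and satisfies G̲''(y) + (1/y + y φ_α(y)) G̲'(y) ≥ (λ/α) ψ_α(y) + (G̲'(y))² f'(G⁻¹(G̲(y))) for all y ∈ (0,√α). Then v̄ := G⁻¹ ∘ G̲ is a positive super-solution of the rescaled problem: v̄ > 0 on [0,√α], v̄'(0) = 0, v̄(√α) ≥ 0, and −v̄''(y) − (1/y + y φ_α(y)) v̄'(y) ≥ (λ/α) ψ_α(y) f(v̄(y)) for all y ∈ (0,√α).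 -/
open Set MeasureTheory Filter

lemma aux_pos (b : ℝ) (g g' φ q : ℝ → ℝ) (hc : ContinuousOn g (Icc 0 b)) (h0 : g 0 = 0)
    (hd : ∀ y ∈ Ioo 0 b, HasDerivAt g (g' y) y)
    (hφ0 : ∀ y ∈ Ioo 0 b, 0 ≤ φ y) (hφ1 : ∀ y ∈ Ioo 0 b, φ y ≤ 1)
    (hq : ∀ y ∈ Ioo 0 b, 0 ≤ q y)
    (hq0 : ∃ δ > 0, ∀ y ∈ Ioo 0 b, y < δ → 0 < q y)
    (hin : ∀ y ∈ Ioo 0 b, q y ≤ g' y + (1 / y + y * φ y) * g y) :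
    ∀ y ∈ Ioo 0 b, 0 < g y := by
  have hnn : ∀ y ∈ Ioo 0 b, 0 ≤ g y := by
    intro y hy
    by_contra! hneg
    obtain ⟨z, hz, hmin⟩ := isCompact_Icc.exists_isMinOn (nonempty_Icc.2 hy.1.le)
      (hc.mono (Icc_subset_Icc_right hy.2.le))
    have hzn : g z < 0 := lt_of_le_of_lt (hmin (right_mem_Icc.2 hy.1.le)) hneg
    have hz0 : 0 < z := by
      rcases hz.1.eq_or_lt with h | h
      · rw [← h, h0] at hzn; exact absurd hzn (lt_irrefl _)
      · exact h
    have hzI : z ∈ Ioo 0 b := ⟨hz0, hz.2.trans_lt hy.2⟩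
    have hcone : (0:ℝ) - z ∈ posTangentConeAt (Icc 0 y) z := by
      apply sub_mem_posTangentConeAt_of_segment_subset
      exact (convex_Icc 0 y).segment_subset hz (left_mem_Icc.2 hy.1.le)
    have h1 := (hmin.localize).hasFDerivWithinAt_nonneg
      (hd z hzI).hasDerivWithinAt.hasFDerivWithinAt hcone
    simp at h1
    have h2 := hin z hzI
    have h3 := hq z hzI
    have h4 : 0 < 1 / z + z * φ z := by
      have := hφ0 z hzI
      positivity
    have h5 : (1 / z + z * φ z) * g z < 0 := mul_neg_of_pos_of_neg h4 hzn
    have h6 : 0 < g' z := by linarith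
    nlinarith
  intro y hy
  refine lt_of_le_of_ne (hnn y hy) fun hgy => ?_
  set h : ℝ → ℝ := fun y => y * Real.exp (y ^ 2 / 2) * g y with hh
  have hhd : ∀ z ∈ Ioo 0 b, HasDerivAt h
      (z * Real.exp (z ^ 2 / 2) * (g' z + (1 / z + z) * g z)) z := by
    intro z hz
    have e1 : HasDerivAt (fun y : ℝ => Real.exp (y ^ 2 / 2)) (Real.exp (z ^ 2 / 2) * z) z := by
      have := ((hasDerivAt_pow 2 z).div_const 2).exp
      refine this.congr_deriv ?_
      simp
    have := ((hasDerivAt_id z).mul e1).mul (hd z hz)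
    refine this.congr_deriv ?_
    have := hz.1.ne'
    simp only [id_eq, one_mul, Pi.mul_apply]
    field_simp
    ring
  have hmono : MonotoneOn h (Icc 0 y) := by
    have hsub : ∀ z ∈ Ioo 0 y, z ∈ Ioo 0 b := fun z hz => ⟨hz.1, hz.2.trans hy.2⟩
    apply monotoneOn_of_deriv_nonneg (convex_Icc 0 y)
    · have := hc.mono (Icc_subset_Icc_right hy.2.le)
      exact ContinuousOn.mul (by fun_prop) this
    · rw [interior_Icc]
      exact fun z hz => (hhd z (hsub z hz)).differentiableAt.differentiableWithinAt
    · rw [interior_Icc]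
      intro z hz
      rw [(hhd z (hsub z hz)).deriv]
      have hz0 := hz.1
      have a1 := hin z (hsub z hz)
      have a2 := hq z (hsub z hz)
      have a3 := hφ1 z (hsub z hz)
      have a4 := hnn z (hsub z hz)
      have : z * φ z * g z ≤ z * g z := by
        have : z * φ z ≤ z * 1 := by gcongr
        nlinarith
      have : 0 ≤ g' z + (1 / z + z) * g z := by nlinarith
      positivity
  have hzero : ∀ z ∈ Ioo 0 y, g z = 0 := by
    intro z hz
    have h1 : h z ≤ h y := hmono ⟨hz.1.le, hz.2.le⟩ (right_mem_Icc.2 hy.1.le) hz.2.le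
    have h2 : h y = 0 := by simp [hh, ← hgy]
    have h3 := hnn z ⟨hz.1, hz.2.trans hy.2⟩
    have h4 : 0 < z * Real.exp (z ^ 2 / 2) := mul_pos hz.1 (Real.exp_pos _)
    rw [h2] at h1
    simp only [hh] at h1
    nlinarith
  obtain ⟨δ, hδ, hqδ⟩ := hq0
  obtain ⟨z, hz1, hz2⟩ := exists_between (lt_min hy.1 hδ)
  have hzy : z ∈ Ioo 0 y := ⟨hz1, hz2.trans_le (min_le_left _ _)⟩
  have hzb : z ∈ Ioo 0 b := ⟨hz1, hzy.2.trans hy.2⟩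
  have h1 := hqδ z hzb (hz2.trans_le (min_le_right _ _))
  have h2 := hin z hzb
  have h3 : g' z = 0 := by
    have e : g =ᶠ[nhds z] fun _ => (0:ℝ) := by
      filter_upwards [Ioo_mem_nhds hzy.1 hzy.2] with w hw using hzero w hw
    exact (hd z hzb).unique ((hasDerivAt_const z (0:ℝ)).congr_of_eventuallyEq e)
  rw [h3, hzero z hzy] at h2
  linarith

lemma aux_deriv (D : GelfandData) (s : Set ℝ) (Gl vbar : ℝ → ℝ)
    (hv : ∀ y ∈ s, 0 ≤ vbar y ∧ (∫ s in Ioi (vbar y), 1 / D.f s) = Gl y)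
    (y : ℝ) (hy : y ∈ s) (d : ℝ) (hd : HasDerivWithinAt Gl d s y) :
    HasDerivWithinAt vbar (-(D.f (vbar y) * d)) s y := by
  set F : ℝ → ℝ := fun t => 1 / D.f (max t 0) with hF
  have hpos : ∀ t, 0 < D.f (max t 0) := fun t => D.f_pos _ (le_max_right _ _)
  have hFc : Continuous F := by
    have : Continuous fun t => D.f (max t 0) :=
      D.f_smooth.continuousOn.comp_continuous (by fun_prop) (fun t => le_max_right t 0)
    exact continuous_const.div this fun t => (hpos t).ne'
  set G : ℝ → ℝ := fun v => D.K - ∫ t in (0:ℝ)..v, F t with hG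
  have hGd : ∀ v, HasStrictDerivAt G (-F v) v := fun v =>
    (hFc.integral_hasStrictDerivAt 0 v).const_sub _
  have hanti : StrictAnti G := by
    apply strictAnti_of_deriv_neg
    intro v
    rw [(hGd v).hasDerivAt.deriv]
    have : 0 < F v := one_div_pos.2 (hpos v)
    linarith
  have hGv : ∀ z ∈ s, G (vbar z) = Gl z := by
    intro z hz
    obtain ⟨h1, h2⟩ := hv z hz
    have h3 := intervalIntegral.integral_Ioi_sub_Ioi D.f_int h1
    have h4 : ∫ t in (0:ℝ)..vbar z, F t = ∫ t in (0:ℝ)..vbar z, 1 / D.f t := by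
      apply intervalIntegral.integral_congr
      intro t ht
      rw [uIcc_of_le h1] at ht
      simp [hF, max_eq_left ht.1]
    simp only [hG]
    rw [h4, D.K_def]
    linarith
  have hne : -F (vbar y) ≠ 0 := neg_ne_zero.2 (one_div_pos.2 (hpos _)).ne'
  have hL := ((hGd (vbar y)).to_localInverse hne).hasDerivAt
  have hR := (hGd (vbar y)).eventually_right_inverse hne
  rw [hGv y hy] at hL hR
  have hcomp := hL.comp_hasDerivWithinAt y hd
  have hev : ∀ z ∈ s, G ((hGd (vbar y)).localInverse G (-F (vbar y)) (vbar y) hne (Gl z)) = Gl z →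
      vbar z = (hGd (vbar y)).localInverse G (-F (vbar y)) (vbar y) hne (Gl z) := by
    intro z hz h
    exact hanti.injective ((hGv z hz).trans h.symm)
  have := hcomp.congr_of_eventuallyEq (f₁ := vbar) (by
    filter_upwards [hd.continuousWithinAt.eventually hR, self_mem_nhdsWithin] with z h1 h2
      using hev z h2 h1) (hev y hy hR.self_of_nhds)
  refine this.congr_deriv ?_
  simp [hF, max_eq_left (hv y hy).1]

/-- If `G̲` is a positive sub-solution of the rescaled problem for `G`
(with `G v = ∫_v^∞ ds/f(s)`), then `v̄ = G⁻¹ ∘ G̲` (characterized here by `v̄ ≥ 0` and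
`G(v̄ y) = G̲ y`) is a positive super-solution of the rescaled problem for `v`. -/
theorem subsolution_gives_supersolution (D : GelfandData) (α lam : ℝ)
    (hα : 0 < α) (hlam : 0 < lam) (Gl vbar : ℝ → ℝ)
    (hG1 : ContDiffOn ℝ 1 Gl (Icc 0 (Real.sqrt α)))
    (hG2 : ContDiffOn ℝ 2 Gl (Ioo 0 (Real.sqrt α)))
    (hGpos : ∀ y ∈ Icc (0:ℝ) (Real.sqrt α), 0 < Gl y)
    (hGd0 : derivWithin Gl (Icc 0 (Real.sqrt α)) 0 = 0)
    (hGK : Gl (Real.sqrt α) ≤ D.K)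
    (hvbar : ∀ y ∈ Icc (0:ℝ) (Real.sqrt α),
      0 ≤ vbar y ∧ (∫ s in Ioi (vbar y), 1 / D.f s) = Gl y)
    (hGineq : ∀ y ∈ Ioo (0:ℝ) (Real.sqrt α),
      derivWithin (derivWithin Gl (Icc 0 (Real.sqrt α))) (Ioo 0 (Real.sqrt α)) y
        + (1 / y + y * D.phi (y / Real.sqrt α)) * derivWithin Gl (Icc 0 (Real.sqrt α)) y
      ≥ (lam / α) * D.psi (y / Real.sqrt α)
        + (derivWithin Gl (Icc 0 (Real.sqrt α)) y) ^ 2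
            * derivWithin D.f (Ici 0) (vbar y)) :
    ContDiffOn ℝ 1 vbar (Icc 0 (Real.sqrt α)) ∧
    ContDiffOn ℝ 2 vbar (Ioo 0 (Real.sqrt α)) ∧
    (∀ y ∈ Ico (0:ℝ) (Real.sqrt α), 0 < vbar y) ∧
    derivWithin vbar (Icc 0 (Real.sqrt α)) 0 = 0 ∧
    0 ≤ vbar (Real.sqrt α) ∧
    ∀ y ∈ Ioo (0:ℝ) (Real.sqrt α),
      (lam / α) * D.psi (y / Real.sqrt α) * D.f (vbar y) ≤
        -(derivWithin (derivWithin vbar (Icc 0 (Real.sqrt α))) (Ioo 0 (Real.sqrt α)) y)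
          - (1 / y + y * D.phi (y / Real.sqrt α))
              * derivWithin vbar (Icc 0 (Real.sqrt α)) y := by
  set b := Real.sqrt α with hb
  have hb0 : 0 < b := Real.sqrt_pos.2 hα
  set g := derivWithin Gl (Icc 0 b) with hg
  have hU : UniqueDiffOn ℝ (Icc 0 b) := uniqueDiffOn_Icc hb0
  have hsub : ∀ y ∈ Ioo 0 b, y ∈ Icc 0 b := fun y hy => Ioo_subset_Icc_self hy
  have hgd : ∀ y ∈ Icc 0 b, HasDerivWithinAt Gl (g y) (Icc 0 b) y := fun y hy =>
    ((hG1.differentiableOn one_ne_zero) y hy).hasDerivWithinAt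
  have hgc : ContinuousOn g (Icc 0 b) := ((contDiffOn_one_iff_derivWithin hU).1 hG1).2
  have hg1 : ContDiffOn ℝ 1 g (Ioo 0 b) := by
    have h2 : ContDiffOn ℝ (1 + 1) Gl (Ioo 0 b) := by
      rw [one_add_one_eq_two]; exact hG2
    refine ((contDiffOn_succ_iff_deriv_of_isOpen isOpen_Ioo).1 h2).2.2.congr fun y hy => ?_
    exact derivWithin_of_mem_nhds (Icc_mem_nhds hy.1 hy.2)
  set g2 := derivWithin g (Ioo 0 b) with hg2
  have hg2d : ∀ y ∈ Ioo 0 b, HasDerivAt g (g2 y) y := fun y hy =>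
    ((hg1.differentiableOn one_ne_zero) y hy).hasDerivWithinAt.hasDerivAt (Ioo_mem_nhds hy.1 hy.2)
  have hvd : ∀ y ∈ Icc 0 b, HasDerivWithinAt vbar (-(D.f (vbar y) * g y)) (Icc 0 b) y :=
    fun y hy => aux_deriv D _ Gl vbar hvbar y hy _ (hgd y hy)
  have hvd' : ∀ y ∈ Icc 0 b, derivWithin vbar (Icc 0 b) y = -(D.f (vbar y) * g y) :=
    fun y hy => (hvd y hy).derivWithin (hU y hy)
  have hvmap : MapsTo vbar (Icc 0 b) (Ici 0) := fun y hy => (hvbar y hy).1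
  have hvmap' : MapsTo vbar (Ioo 0 b) (Ici 0) := fun y hy => (hvbar y (hsub y hy)).1
  have hvc : ContinuousOn vbar (Icc 0 b) := fun y hy => (hvd y hy).continuousWithinAt
  have hv1 : ContDiffOn ℝ 1 vbar (Icc 0 b) := by
    rw [contDiffOn_one_iff_derivWithin hU]
    refine ⟨fun y hy => (hvd y hy).differentiableWithinAt, ContinuousOn.congr ?_ hvd'⟩
    exact ((D.f_smooth.continuousOn.comp hvc hvmap).mul hgc).neg
  have hv1' : ContDiffOn ℝ 1 (fun y => -(D.f (vbar y) * g y)) (Ioo 0 b) :=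
    ((D.f_smooth.comp (hv1.mono Ioo_subset_Icc_self) hvmap').mul hg1).neg
  have hv2 : ContDiffOn ℝ 2 vbar (Ioo 0 b) := by
    rw [← one_add_one_eq_two, contDiffOn_succ_iff_deriv_of_isOpen isOpen_Ioo]
    refine ⟨(hv1.mono Ioo_subset_Icc_self).differentiableOn one_ne_zero, by simp, hv1'.congr ?_⟩
    intro y hy
    exact ((hvd y (hsub y hy)).hasDerivAt (Icc_mem_nhds hy.1 hy.2)).deriv
  have hdiv : ∀ y ∈ Ioo 0 b, y / b ∈ Icc (0:ℝ) 1 := fun y hy =>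
    ⟨div_nonneg hy.1.le hb0.le, (div_le_one hb0).2 hy.2.le⟩
  have hf' : ∀ t, 0 ≤ derivWithin D.f (Ici 0) t := fun t => D.f_mono.derivWithin_nonneg
  have hgpos : ∀ y ∈ Ioo 0 b, 0 < g y := by
    apply aux_pos b g g2 (fun y => D.phi (y / b)) (fun y => lam / α * D.psi (y / b)) hgc hGd0 hg2d
    · exact fun y hy => D.phi_nonneg _ (hdiv y hy)
    · intro y hy
      have := D.phi_anti (left_mem_Icc.2 zero_le_one) (hdiv y hy) (hdiv y hy).1
      rwa [D.phi_zero] at this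
    · exact fun y hy => mul_nonneg (by positivity) (D.psi_nonneg _ (hdiv y hy))
    · obtain ⟨L, hL⟩ := D.psi_lip
      have hc : ContinuousWithinAt D.psi (Icc 0 1) 0 := hL.continuousOn 0 (left_mem_Icc.2 zero_le_one)
      have h1 : ∀ᶠ r in nhdsWithin 0 (Icc 0 1), 0 < D.psi r :=
        hc.eventually (lt_mem_nhds (by rw [D.psi_zero]; exact one_pos))
      rw [eventually_nhdsWithin_iff, Metric.eventually_nhds_iff] at h1
      obtain ⟨ε, hε, h⟩ := h1
      refine ⟨ε * b, by positivity, fun y hy hlt => ?_⟩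
      have : 0 < D.psi (y / b) := by
        apply h _ (hdiv y hy)
        rw [Real.dist_eq, sub_zero, abs_of_nonneg (hdiv y hy).1, div_lt_iff₀ hb0]
        exact hlt
      positivity
    · intro y hy
      have h1 := hGineq y hy
      have h2 := mul_nonneg (sq_nonneg (g y)) (hf' (vbar y))
      linarith
  have hstrict : StrictMonoOn Gl (Icc 0 b) := by
    apply strictMonoOn_of_deriv_pos (convex_Icc 0 b) hG1.continuousOn
    rw [interior_Icc]
    intro y hy
    rw [((hgd y (hsub y hy)).hasDerivAt (Icc_mem_nhds hy.1 hy.2)).deriv]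
    exact hgpos y hy
  refine ⟨hv1, hv2, ?_, ?_, (hvbar b (right_mem_Icc.2 hb0.le)).1, ?_⟩
  · intro y hy
    have hyI : y ∈ Icc 0 b := Ico_subset_Icc_self hy
    have h1 := hstrict hyI (right_mem_Icc.2 hb0.le) hy.2
    refine lt_of_le_of_ne (hvbar y hyI).1 fun h => ?_
    have h2 := (hvbar y hyI).2
    rw [← h, ← D.K_def] at h2
    linarith
  · rw [hvd' 0 (left_mem_Icc.2 hb0.le), hGd0]
    simp
  · intro y hy
    have hyI := hsub y hy
    have hnb := Ioo_mem_nhds hy.1 hy.2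
    have hfd : HasDerivWithinAt D.f (derivWithin D.f (Ici 0) (vbar y)) (Ici 0) (vbar y) :=
      ((D.f_smooth.differentiableOn one_ne_zero) _ (hvmap hyI)).hasDerivWithinAt
    have hcomp := hfd.comp y ((hvd y hyI).mono Ioo_subset_Icc_self) hvmap'
    have hprod := (hcomp.mul (hg2d y hy).hasDerivWithinAt).neg
    have h2 : derivWithin (derivWithin vbar (Icc 0 b)) (Ioo 0 b) y =
        -(derivWithin D.f (Ici 0) (vbar y) * -(D.f (vbar y) * g y) * g y
          + D.f (vbar y) * g2 y) := by
      refine (hprod.congr_of_mem (fun z hz => ?_) hy).derivWithin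
        (isOpen_Ioo.uniqueDiffWithinAt hy)
      exact hvd' z (hsub z hz)
    rw [h2, hvd' y hyI]
    have h3 := mul_le_mul_of_nonneg_left (hGineq y hy) (D.f_pos _ (hvmap hyI)).le
    linarith
end

section
/- There exist constants c > 0 and α₀ such that for every α ≥ α₀: if problem (P_{α,λ}) admits a solution for some λ > 0, then λ ≤ (2Kα / log α)(1 + c / log α). In particular λ*(α) ≤ (2Kα / log α)(1 + c / log α) for α ≥ α₀. -/
open Set MeasureTheory Filter

theorem aux_derivs {u : ℝ → ℝ} (h1 : ContDiffOn ℝ 1 u (Icc 0 1))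
    (h2 : ContDiffOn ℝ 2 u (Ioo 0 1)) {r : ℝ} (hr : r ∈ Ioo (0:ℝ) 1) :
    HasDerivAt u (derivWithin u (Icc 0 1) r) r ∧
    HasDerivAt (derivWithin u (Icc 0 1))
      (derivWithin (derivWithin u (Icc 0 1)) (Ioo 0 1) r) r := by
  constructor
  · have := (h1.differentiableOn (by norm_num) r (Ioo_subset_Icc_self hr)).hasDerivWithinAt
    exact this.hasDerivAt (Icc_mem_nhds hr.1 hr.2)
  · have h3 : ContDiffOn ℝ 1 (derivWithin u (Ioo 0 1)) (Ioo 0 1) :=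
      h2.derivWithin isOpen_Ioo.uniqueDiffOn (by norm_num)
    have h4 : ∀ x ∈ Ioo (0:ℝ) 1, derivWithin u (Icc 0 1) x = derivWithin u (Ioo 0 1) x := by
      intro x hx
      rw [derivWithin_of_mem_nhds (Icc_mem_nhds hx.1 hx.2),
        derivWithin_of_mem_nhds (Ioo_mem_nhds hx.1 hx.2)]
    have h5 : DifferentiableOn ℝ (derivWithin u (Icc 0 1)) (Ioo 0 1) :=
      (h3.differentiableOn (by norm_num)).congr h4
    exact (h5 r hr).hasDerivWithinAt.hasDerivAt (Ioo_mem_nhds hr.1 hr.2)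

theorem aux_left_min {v : ℝ → ℝ} {d m : ℝ} (hm : 0 < m) (h : HasDerivAt v d m)
    (hmax : ∀ s ∈ Icc 0 m, v s ≤ v m) : 0 ≤ d := by
  have h1 := (hasDerivWithinAt_iff_tendsto_slope' (s := Iio m) (by simp)).1
    (h.hasDerivWithinAt (s := Iio m))
  refine ge_of_tendsto h1 ?_
  filter_upwards [Ioo_mem_nhdsLT hm] with s hs
  rw [slope_def_field]
  exact div_nonneg_of_nonpos (by linarith [hmax s ⟨hs.1.le, hs.2.le⟩]) (by linarith [hs.2])

theorem aux_vnonpos {D : GelfandData} {α lam : ℝ} {u : ℝ → ℝ} (hα : 0 < α) (hl : 0 < lam)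
    (h : IsSolution D α lam u) : ∀ r ∈ Ioo (0:ℝ) 1, derivWithin u (Icc 0 1) r ≤ 0 := by
  obtain ⟨h1, h2, hpos, h0, hu1, heq⟩ := h
  intro r hr
  by_contra hlt
  push Not at hlt
  have hc : ContinuousOn (derivWithin u (Icc 0 1)) (Icc 0 r) :=
    (h1.continuousOn_derivWithin (uniqueDiffOn_Icc (by norm_num)) le_rfl).mono
      (Icc_subset_Icc le_rfl hr.2.le)
  obtain ⟨m, hm, hmax⟩ := isCompact_Icc.exists_isMaxOn (nonempty_Icc.2 hr.1.le) hc
  have hvm : 0 < derivWithin u (Icc 0 1) m := lt_of_lt_of_le hlt (hmax ⟨hr.1.le, le_rfl⟩)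
  have hm0 : 0 < m := by
    rcases hm.1.eq_or_lt with h | h
    · rw [← h, h0] at hvm; exact absurd hvm (lt_irrefl _)
    · exact h
  have hm1 : m ∈ Ioo (0:ℝ) 1 := ⟨hm0, lt_of_le_of_lt hm.2 hr.2⟩
  have hd := aux_left_min hm0 (aux_derivs h1 h2 hm1).2
    (fun s hs => hmax ⟨hs.1, hs.2.trans hm.2⟩)
  have he := heq m hm1
  have h3 : 0 < (1 / m + α * m * D.phi m) := by
    have := D.phi_nonneg m ⟨hm0.le, hm1.2.le⟩
    positivity
  have h4 : 0 ≤ lam * D.psi m * D.f (u m) := by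
    have := D.psi_nonneg m ⟨hm0.le, hm1.2.le⟩
    have := D.f_pos (u m) (hpos m ⟨hm0.le, hm1.2⟩).le
    positivity
  have := mul_pos h3 hvm
  linarith

theorem aux_key {D : GelfandData} {α lam : ℝ} {u : ℝ → ℝ} (hα : 0 < α) (hl : 0 < lam)
    (h : IsSolution D α lam u) : ∀ r ∈ Ioo (0:ℝ) 1,
      lam * D.psi r * D.f (u r) * (1 - 2 / (α * r ^ 2)) ≤
        α * r * (- derivWithin u (Icc 0 1) r) := by
  have hv := aux_vnonpos hα hl h
  obtain ⟨h1, h2, hpos, h0, hu1, heq⟩ := h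
  have hanti : AntitoneOn u (Icc 0 1) := by
    apply antitoneOn_of_deriv_nonpos (convex_Icc 0 1) h1.continuousOn
    · intro x hx
      rw [interior_Icc] at hx
      exact (aux_derivs h1 h2 hx).1.differentiableAt.differentiableWithinAt
    · intro x hx
      rw [interior_Icc] at hx
      rw [(aux_derivs h1 h2 hx).1.deriv]
      exact hv x hx
  intro r hr
  set c := lam * D.psi r * D.f (u r) with hcdef
  have hψr := D.psi_nonneg r ⟨hr.1.le, hr.2.le⟩
  have hfr := D.f_pos (u r) (hpos r ⟨hr.1.le, hr.2⟩).le
  have hc0 : 0 ≤ c := by positivity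
  set v := derivWithin u (Icc 0 1) with hvdef
  have hvc : ContinuousOn v (Icc 0 r) :=
    (h1.continuousOn_derivWithin (uniqueDiffOn_Icc (by norm_num)) le_rfl).mono
      (Icc_subset_Icc le_rfl hr.2.le)
  have hE : ∀ s : ℝ, HasDerivAt (fun s => Real.exp (α * s ^ 2 / 2))
      (Real.exp (α * s ^ 2 / 2) * (α * s)) s := by
    intro s
    have : HasDerivAt (fun s : ℝ => α * s ^ 2 / 2) (α * s) s := by
      refine (((hasDerivAt_pow 2 s).const_mul α).div_const 2).congr_deriv ?_
      norm_num
      ring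
    exact this.exp
  have hmono : MonotoneOn (fun s => s * Real.exp (α * s ^ 2 / 2) * (- v s)
      - c * Real.exp (α * s ^ 2 / 2) / α) (Icc 0 r) := by
    have hder : ∀ x ∈ Ioo 0 r, HasDerivAt (fun s => s * Real.exp (α * s ^ 2 / 2) * (- v s)
      - c * Real.exp (α * s ^ 2 / 2) / α)
        ((1 * Real.exp (α * x ^ 2 / 2) + x * (Real.exp (α * x ^ 2 / 2) * (α * x))) * (- v x)
        + x * Real.exp (α * x ^ 2 / 2) * (- derivWithin v (Ioo 0 1) x)
        - c * (Real.exp (α * x ^ 2 / 2) * (α * x)) / α) x := by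
      intro x hx
      have hx1 : x ∈ Ioo (0:ℝ) 1 := ⟨hx.1, hx.2.trans hr.2⟩
      exact (((hasDerivAt_id x).mul (hE x)).mul (aux_derivs h1 h2 hx1).2.neg).sub
        (((hE x).const_mul c).div_const α)
    apply monotoneOn_of_deriv_nonneg (convex_Icc 0 r)
    · fun_prop
    · intro x hx
      rw [interior_Icc] at hx
      exact (hder x hx).differentiableAt.differentiableWithinAt
    · intro x hx
      rw [interior_Icc] at hx
      rw [(hder x hx).deriv]
      have hx1 : x ∈ Ioo (0:ℝ) 1 := ⟨hx.1, hx.2.trans hr.2⟩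
      have hxI : x ∈ Icc (0:ℝ) 1 := ⟨hx1.1.le, hx1.2.le⟩
      have hrI : r ∈ Icc (0:ℝ) 1 := ⟨hr.1.le, hr.2.le⟩
      have he := heq x hx1
      have hx0 := hx.1
      have hphi : D.phi x ≤ 1 := by
        rw [← D.phi_zero]; exact D.phi_anti ⟨le_rfl, zero_le_one⟩ hxI hxI.1
      have hψ : D.psi r ≤ D.psi x := D.psi_anti hxI hrI hx.2.le
      have hf : D.f (u r) ≤ D.f (u x) :=
        D.f_mono (hpos r ⟨hr.1.le, hr.2⟩).le (hpos x ⟨hx1.1.le, hx1.2⟩).le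
          (hanti hxI hrI hx.2.le)
      have hcc : c ≤ lam * D.psi x * D.f (u x) := by
        rw [hcdef]; gcongr
        exact mul_nonneg hl.le (D.psi_nonneg x hxI)
      have hvx := hv x hx1
      have e1 : (1 * Real.exp (α * x ^ 2 / 2) + x * (Real.exp (α * x ^ 2 / 2) * (α * x))) * (- v x)
        + x * Real.exp (α * x ^ 2 / 2) * (- derivWithin v (Ioo 0 1) x)
        - c * (Real.exp (α * x ^ 2 / 2) * (α * x)) / α =
        x * Real.exp (α * x ^ 2 / 2) * ((- derivWithin v (Ioo 0 1) x
          - (1 / x + α * x * D.phi x) * v x) - c + α * x * (1 - D.phi x) * (- v x)) := by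
        field_simp
        ring
      rw [e1, he]
      have h5 : 0 ≤ α * x * (1 - D.phi x) * (- v x) :=
        mul_nonneg (mul_nonneg (by positivity) (by linarith)) (by linarith)
      exact mul_nonneg (by positivity) (by linarith)
  have hm := hmono ⟨le_rfl, hr.1.le⟩ ⟨hr.1.le, le_rfl⟩ hr.1.le
  have hr0 := hr.1
  simp only [zero_mul, zero_sub] at hm
  norm_num at hm
  have hEp : 0 < Real.exp (α * r ^ 2 / 2) := Real.exp_pos _
  have hEl : α * r ^ 2 / 2 ≤ Real.exp (α * r ^ 2 / 2) := by
    linarith [Real.add_one_le_exp (α * r ^ 2 / 2)]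
  set E := Real.exp (α * r ^ 2 / 2)
  have h6 : c * (1 - 1 / E) ≤ α * r * (- v r) := by
    have h7 : c * (E - 1) ≤ (α * r * (- v r)) * E := by
      have := mul_le_mul_of_nonneg_left hm hα.le
      field_simp at this
      linarith
    have h8 : c * (1 - 1 / E) = c * (E - 1) / E := by field_simp
    rw [h8, div_le_iff₀ hEp]
    exact h7
  refine le_trans ?_ h6
  apply mul_le_mul_of_nonneg_left _ hc0
  have : 1 / E ≤ 2 / (α * r ^ 2) := by
    rw [div_le_div_iff₀ hEp (by positivity)]
    linarith
  linarith

theorem aux_main (D : GelfandData) : ∃ L : ℝ, 0 ≤ L ∧ ∀ α > (1:ℝ), ∀ lam > (0:ℝ),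
    (∃ u, IsSolution D α lam u) → lam * (Real.log α / 2 - L - 1) ≤ D.K * α := by
  obtain ⟨L, hL⟩ := D.psi_lip
  refine ⟨L, L.2, ?_⟩
  rintro α hα1 lam hl ⟨u, h⟩
  have hα : 0 < α := by linarith
  have hkey := aux_key hα hl h
  obtain ⟨h1, h2, hpos, h0, hu1, heq⟩ := h
  have hg : Continuous (fun t => 1 / D.f (max t 0)) := by
    have : Continuous (fun t => D.f (max t 0)) :=
      D.f_smooth.continuousOn.comp_continuous (by fun_prop) (fun t => mem_Ici.2 (le_max_right _ _))
    exact continuous_const.div this (fun t => (D.f_pos _ (le_max_right _ _)).ne')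
  set F : ℝ → ℝ := fun t => ∫ s in (0:ℝ)..t, 1 / D.f (max s 0) with hF
  have hFd : ∀ t, HasDerivAt F (1 / D.f (max t 0)) t := fun t =>
    intervalIntegral.integral_hasDerivAt_right (hg.intervalIntegrable _ _)
      hg.aestronglyMeasurable.stronglyMeasurableAtFilter hg.continuousAt
  have hFK : ∀ t, 0 ≤ t → F t ≤ D.K := by
    intro t ht
    rw [hF, D.K_def]
    simp only
    rw [intervalIntegral.integral_of_le ht]
    have : ∫ s in Ioc 0 t, 1 / D.f (max s 0) = ∫ s in Ioc 0 t, 1 / D.f s := by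
      apply setIntegral_congr_fun measurableSet_Ioc
      intro s hs
      simp only
      rw [max_eq_left hs.1.le]
    rw [this]
    apply setIntegral_mono_set D.f_int
    · filter_upwards [ae_restrict_mem measurableSet_Ioi] with s hs
      exact div_nonneg zero_le_one (D.f_pos s (le_of_lt hs)).le
    · exact (Ioc_subset_Ioi_self).eventuallyLE
  have hFc : Continuous F := continuous_iff_continuousAt.2 fun t => (hFd t).continuousAt
  set a : ℝ := (Real.sqrt α)⁻¹ with ha
  have hs1 : 1 < Real.sqrt α := by rw [Real.lt_sqrt] <;> linarith
  have ha0 : 0 < a := by positivity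
  have ha1 : a < 1 := inv_lt_one_of_one_lt₀ hs1
  have ha2 : α * a ^ 2 = 1 := by
    rw [ha, inv_pow, Real.sq_sqrt hα.le]; field_simp
  have hla : Real.log a = - (Real.log α / 2) := by
    rw [ha, Real.log_inv, Real.log_sqrt hα.le]
  have hder : ∀ x ∈ Ioo a 1, HasDerivAt
      (fun r => F (u r) + lam * (Real.log r / α - L * r / α + (r ^ 2)⁻¹ / α ^ 2))
      (1 / D.f (max (u x) 0) * derivWithin u (Icc 0 1) x +
        lam * (x⁻¹ / α - L * 1 / α + (-(2 * x) / (x ^ 2) ^ 2) / α ^ 2)) x := by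
    intro x hx
    have hx0 : 0 < x := ha0.trans hx.1
    have hx1 : x ∈ Ioo (0:ℝ) 1 := ⟨hx0, hx.2⟩
    have hp : HasDerivAt (fun r : ℝ => r ^ 2) (2 * x) x := by
      simpa using hasDerivAt_pow 2 x
    have hi : HasDerivAt (fun r : ℝ => (r ^ 2)⁻¹) (-(2 * x) / (x ^ 2) ^ 2) x :=
      hp.fun_inv (by positivity)
    exact ((hFd (u x)).comp x (aux_derivs h1 h2 hx1).1).add
      (((((Real.hasDerivAt_log hx0.ne').div_const α).sub
        (((hasDerivAt_id x).const_mul (L:ℝ)).div_const α)).add (hi.div_const (α ^ 2))).const_mul lam)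
  have hanti : AntitoneOn
      (fun r => F (u r) + lam * (Real.log r / α - L * r / α + (r ^ 2)⁻¹ / α ^ 2)) (Icc a 1) := by
    apply antitoneOn_of_deriv_nonpos (convex_Icc a 1)
    · have hne : ∀ x ∈ Icc a 1, x ≠ 0 := fun x hx => (ha0.trans_le hx.1).ne'
      have hne2 : ∀ x ∈ Icc a 1, x ^ 2 ≠ 0 := fun x hx => pow_ne_zero 2 (hne x hx)
      have hlog : ContinuousOn Real.log (Icc a 1) :=
        Real.continuousOn_log.mono (fun x hx => hne x hx)
      have hinv : ContinuousOn (fun x : ℝ => (x ^ 2)⁻¹) (Icc a 1) :=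
        (continuous_pow 2).continuousOn.inv₀ hne2
      have huc : ContinuousOn (fun r => F (u r)) (Icc a 1) :=
        hFc.comp_continuousOn (h1.continuousOn.mono (Icc_subset_Icc ha0.le le_rfl))
      exact huc.add (continuousOn_const.mul (((hlog.div_const α).sub
        ((continuousOn_const.mul continuousOn_id).div_const α)).add (hinv.div_const _)))
    · intro x hx
      rw [interior_Icc] at hx
      exact (hder x hx).differentiableAt.differentiableWithinAt
    · intro x hx
      rw [interior_Icc] at hx
      rw [(hder x hx).deriv]
      have hx0 : 0 < x := ha0.trans hx.1
      have hx1 : x ∈ Ioo (0:ℝ) 1 := ⟨hx0, hx.2⟩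
      have hxI : x ∈ Icc (0:ℝ) 1 := ⟨hx1.1.le, hx1.2.le⟩
      have hux := hpos x ⟨hx0.le, hx.2⟩
      rw [max_eq_left hux.le]
      have hfx := D.f_pos _ hux.le
      have hk := hkey x hx1
      have hψ1 : D.psi x ≤ 1 := by
        rw [← D.psi_zero]; exact D.psi_anti ⟨le_rfl, zero_le_one⟩ hxI hxI.1
      have hψ2 : 1 - L * x ≤ D.psi x := by
        have := hL.dist_le_mul 0 ⟨le_rfl, zero_le_one⟩ x hxI
        rw [Real.dist_eq, Real.dist_eq, D.psi_zero, zero_sub, abs_neg, abs_of_pos hx0] at this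
        linarith [le_abs_self (1 - D.psi x)]
      set v := derivWithin u (Icc 0 1) x
      have hq : 0 < 2 / (α * x ^ 2) := by positivity
      have h3 : 1 - L * x - 2 / (α * x ^ 2) ≤ D.psi x * (1 - 2 / (α * x ^ 2)) := by
        nlinarith
      have h4 : lam * (1 - L * x - 2 / (α * x ^ 2)) ≤ α * x * (- v) / D.f (u x) := by
        rw [le_div_iff₀ hfx]
        calc lam * (1 - L * x - 2 / (α * x ^ 2)) * D.f (u x)
            ≤ lam * (D.psi x * (1 - 2 / (α * x ^ 2))) * D.f (u x) := by gcongr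
          _ = lam * D.psi x * D.f (u x) * (1 - 2 / (α * x ^ 2)) := by ring
          _ ≤ _ := hk
      have e : 1 / D.f (u x) * v +
        lam * (x⁻¹ / α - L * 1 / α + (-(2 * x) / (x ^ 2) ^ 2) / α ^ 2) =
        (lam * (1 - L * x - 2 / (α * x ^ 2)) - α * x * (- v) / D.f (u x)) / (α * x) := by
        field_simp
        ring
      rw [e]
      exact div_nonpos_of_nonpos_of_nonneg (by linarith) (by positivity)
  have hfin := hanti ⟨le_rfl, ha1.le⟩ ⟨ha1.le, le_rfl⟩ ha1.le
  have hF0 : F (u 1) = 0 := by rw [hu1, hF]; simp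
  have hFa := hFK (u a) (hpos a ⟨ha0.le, ha1⟩).le
  simp only [hF0, hla, Real.log_one] at hfin
  have ha3 : (a ^ 2)⁻¹ = α := by
    rw [inv_eq_iff_eq_inv]; field_simp; linarith
  rw [ha3] at hfin
  have h5 : lam * (Real.log α / 2 - L + L * a + 1 / α - 1) ≤ α * D.K := by
    have : lam * (Real.log α / 2 - L + L * a + 1 / α - 1) / α ≤ D.K := by
      have e : lam * (Real.log α / 2 - L + L * a + 1 / α - 1) / α =
        lam * (0 / α - L * 1 / α + (1 ^ 2)⁻¹ / α ^ 2) -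
        lam * (-(Real.log α / 2) / α - L * a / α + α / α ^ 2) := by
        field_simp
        ring
      rw [e]; linarith
    rw [div_le_iff₀ hα] at this
    linarith
  have h6 : 0 ≤ L * a + 1 / α := by positivity
  have h7 := mul_nonneg hl.le h6
  linarith

/-- Upper bound: there are `c > 0` and `α₀` such that for `α ≥ α₀`,
solvability of `(P_{α,λ})` forces `λ ≤ (2Kα/log α)(1 + c/log α)`; in particular
`λ*(α) ≤ (2Kα/log α)(1 + c/log α)`. -/
theorem lamStar_upper_bound (D : GelfandData) :
    ∃ c > (0:ℝ), ∃ α₀ : ℝ, ∀ α ≥ α₀,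
      (∀ lam > (0:ℝ), (∃ u, IsSolution D α lam u) →
        lam ≤ 2 * D.K * α / Real.log α * (1 + c / Real.log α)) ∧
      lamStar D α ≤ 2 * D.K * α / Real.log α * (1 + c / Real.log α) := by
  obtain ⟨L, hL0, hmain⟩ := aux_main D
  have hK : 0 ≤ D.K := by
    rw [D.K_def]
    apply setIntegral_nonneg measurableSet_Ioi
    intro s hs
    exact div_nonneg zero_le_one (D.f_pos s (le_of_lt hs)).le
  refine ⟨4 * (L + 1), by positivity, Real.exp (4 * (L + 1)), ?_⟩
  intro α hα
  have hα1 : 1 < α := lt_of_lt_of_le (Real.one_lt_exp_iff.2 (by positivity)) hα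
  have hα0 : 0 < α := by linarith
  have hlog : 4 * (L + 1) ≤ Real.log α := (Real.le_log_iff_exp_le hα0).2 hα
  have hb : ∀ lam > (0:ℝ), (∃ u, IsSolution D α lam u) →
        lam ≤ 2 * D.K * α / Real.log α * (1 + 4 * (L + 1) / Real.log α) := by
    intro lam hl hu
    have h1 := hmain α hα1 lam hl hu
    set l := Real.log α
    have hl0 : 0 < l := by linarith
    have e : 2 * D.K * α / l * (1 + 4 * (L + 1) / l) =
      2 * D.K * α * (l + 4 * (L + 1)) / l ^ 2 := by field_simp
    rw [e, le_div_iff₀ (by positivity)]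
    have h2 : l ^ 2 ≤ (l - 2 * (L + 1)) * (l + 4 * (L + 1)) := by nlinarith
    calc lam * l ^ 2 ≤ lam * ((l - 2 * (L + 1)) * (l + 4 * (L + 1))) := by gcongr
      _ = (2 * (lam * (l / 2 - L - 1))) * (l + 4 * (L + 1)) := by ring
      _ ≤ (2 * (D.K * α)) * (l + 4 * (L + 1)) := by gcongr
      _ = _ := by ring
  refine ⟨hb, ?_⟩
  apply Real.sSup_le
  · rintro lam ⟨hl, hu⟩
    exact hb lam hl hu
  · have : 0 < Real.log α := by linarith
    positivity
end

section
/- For every w > 0 there exist a constant c > 0 and α₀ such that for all α ≥ α₀ the following holds. Set ε_w := ∫_w^∞ ds/f(s) and β_w := 2(K − ε_w)/(log α + c). If G̃ ∈ C²((0,√α)) ∩ C¹([0,√α]) satisfies G̃''(y) + (1/y + y φ_α(y)) G̃'(y) = β_w (ψ_α(y) + M_α(y)²/α) for y ∈ (0,√α), with G̃'(0) = 0 and G̃(√α) = K, then G̃ is strictly increasing on [0,√α] and G̃(y) ≥ ε_w > 0 for all y ∈ [0,√α]. -/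
open Set MeasureTheory Filter

theorem aux_cmp (h h' : ℝ → ℝ) (b : ℝ) (hc : ContinuousOn h (Icc 0 b))
    (hd : ∀ y ∈ Ioo 0 b, HasDerivAt h (h' y) y) (h0 : h 0 ≤ 0)
    (hn : ∀ y ∈ Ioo 0 b, 0 < h y → h' y ≤ 0) : ∀ y ∈ Icc 0 b, h y ≤ 0 := by
  intro y0 hy0
  by_contra hcon
  push Not at hcon
  set T : Set ℝ := Icc 0 y0 ∩ h ⁻¹' Iic 0 with hT
  have hcy : ContinuousOn h (Icc 0 y0) := hc.mono (Icc_subset_Icc_right hy0.2)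
  have hTc : IsClosed T := hcy.preimage_isClosed_of_isClosed isClosed_Icc isClosed_Iic
  have hTne : T.Nonempty := ⟨0, ⟨le_refl _, hy0.1⟩, h0⟩
  have hTb : BddAbove T := ⟨y0, fun x hx => hx.1.2⟩
  have hz := hTc.csSup_mem hTne hTb
  set z := sSup T with hzdef
  have hz0 : 0 ≤ z := hz.1.1
  have hzy : z ≤ y0 := hz.1.2
  have hz2 : h z ≤ 0 := hz.2
  have hpos : ∀ x, z < x → x ≤ y0 → 0 < h x := by
    intro x hx1 hx2
    by_contra hx3
    push Not at hx3
    have : x ≤ z := le_csSup hTb ⟨⟨hz0.trans hx1.le, hx2⟩, hx3⟩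
    linarith
  have hanti : AntitoneOn h (Icc z y0) := by
    apply antitoneOn_of_hasDerivWithinAt_nonpos (convex_Icc z y0)
      (hc.mono (Icc_subset_Icc hz0 hy0.2)) (f' := h')
    · intro x hx
      rw [interior_Icc] at hx
      exact (hd x ⟨hz0.trans_lt hx.1, hx.2.trans_le hy0.2⟩).hasDerivWithinAt
    · intro x hx
      rw [interior_Icc] at hx
      exact hn x ⟨hz0.trans_lt hx.1, hx.2.trans_le hy0.2⟩ (hpos x hx.1 hx.2.le)
  have := hanti ⟨le_refl z, hzy⟩ ⟨hzy, le_refl y0⟩ hzy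
  linarith

theorem aux_inc (G p B B' : ℝ → ℝ) (u v : ℝ) (huv : u ≤ v) (hG : ContinuousOn G (Icc u v))
    (hB : ContinuousOn B (Icc u v))
    (hGd : ∀ y ∈ Ioo u v, HasDerivAt G (p y) y) (hBd : ∀ y ∈ Ioo u v, HasDerivAt B (B' y) y)
    (hle : ∀ y ∈ Ioo u v, p y ≤ B' y) : G v - G u ≤ B v - B u := by
  have hanti : AntitoneOn (fun y => G y - B y) (Icc u v) := by
    apply antitoneOn_of_hasDerivWithinAt_nonpos (convex_Icc u v)
      (hG.sub hB) (f' := fun y => p y - B' y)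
    · intro x hx
      rw [interior_Icc] at hx
      exact ((hGd x hx).sub (hBd x hx)).hasDerivWithinAt
    · intro x hx
      rw [interior_Icc] at hx
      have := hle x hx
      linarith
  have := hanti ⟨le_refl u, huv⟩ ⟨huv, le_refl v⟩ huv
  simp only at this
  linarith

theorem aux_M_mono (D : GelfandData) {s t : ℝ} (hs : 0 ≤ s) (hst : s ≤ t) (ht : t < 1) :
    D.M s ≤ D.M t := by
  obtain ⟨⟨r, hr, hr2⟩, _⟩ := D.M_def s ⟨hs, hst.trans_lt ht⟩
  have := (D.M_def t ⟨hs.trans hst, ht⟩).2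
  exact hr2 ▸ this ⟨r, ⟨hr.1, hr.2.trans hst⟩, rfl⟩

theorem aux_M_one (D : GelfandData) {s : ℝ} (hs : 0 ≤ s) (ht : s < 1) :
    1 ≤ D.M s := by
  have := (D.M_def s ⟨hs, ht⟩).2
  have h2 := this ⟨0, ⟨le_refl _, hs⟩, rfl⟩
  simpa [D.phi_zero, D.psi_zero] using h2

theorem aux_psi_le (D : GelfandData) {s t : ℝ} (hs : 0 ≤ s) (hst : s ≤ t) (ht : t < 1) :
    D.psi s ≤ D.phi s * D.M t := by
  have h1 := (D.M_def t ⟨hs.trans hst, ht⟩).2 ⟨s, ⟨hs, hst⟩, rfl⟩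
  have h2 := D.phi_pos s ⟨hs, hst.trans_lt ht⟩
  simp only at h1
  rw [div_le_iff₀ h2] at h1
  linarith

set_option maxHeartbeats 4000000 in
theorem aux_core (D : GelfandData) : ∃ c > (0:ℝ), ∀ a ≥ (2:ℝ), ∀ β > (0:ℝ), ∀ G p p' : ℝ → ℝ,
    ContinuousOn G (Icc 0 a) → ContinuousOn p (Icc 0 a) →
    (∀ y ∈ Ioo 0 a, HasDerivAt G (p y) y) →
    (∀ y ∈ Ioo 0 a, HasDerivAt p (p' y) y) →
    ContinuousOn D.M (Ioo 0 1) →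
    (∀ y ∈ Ioo 0 a, p' y + (1 / y + y * D.phi (y / a)) * p y
      = β * (D.psi (y / a) + D.M (y / a) ^ 2 / a ^ 2)) →
    (∀ y ∈ Ioo 0 a, 0 < p y) ∧ G a - G 0 ≤ β * (Real.log a + c / 2) := by
  obtain ⟨L, hL⟩ := D.phi_lip
  set δ := D.phi (1/2) with hδ
  have hδ0 : 0 < δ := D.phi_pos _ (by norm_num)
  set m := D.M (1/2) with hm
  have hm1 : 1 ≤ m := aux_M_one D (by norm_num) (by norm_num)
  set F : ℝ → ℝ := fun s => ∫ t in (0:ℝ)..s, D.M t with hF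
  set I := F 1 with hI
  have hint : IntervalIntegrable D.M volume 0 1 := by
    rw [intervalIntegrable_iff_integrableOn_Ioo_of_le zero_le_one]
    exact D.M_int
  have hsub : ∀ s ∈ Icc (0:ℝ) 1, IntervalIntegrable D.M volume 0 s := fun s hs =>
    hint.mono_set (by rw [uIcc_of_le hs.1, uIcc_of_le zero_le_one]; exact Icc_subset_Icc_right hs.2)
  have hsub1 : ∀ s ∈ Icc (0:ℝ) 1, IntervalIntegrable D.M volume s 1 := fun s hs =>
    hint.mono_set (by rw [uIcc_of_le hs.2, uIcc_of_le zero_le_one]; exact Icc_subset_Icc_left hs.1)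
  have hFc : ContinuousOn F (Icc 0 1) := by
    have := intervalIntegral.continuousOn_primitive_interval (μ := volume) (f := D.M)
      (a := 0) (b := 1) (by
        rw [uIcc_of_le zero_le_one, integrableOn_Icc_iff_integrableOn_Ioo]; exact D.M_int)
    rwa [uIcc_of_le zero_le_one] at this
  have hF0 : F 0 = 0 := by simp [hF]
  have hFn : ∀ s ∈ Ico (0:ℝ) 1, 0 ≤ F s := by
    intro s hs
    apply intervalIntegral.integral_nonneg hs.1
    intro u hu
    linarith [aux_M_one D hu.1 (hu.2.trans_lt hs.2)]
  have hFI : ∀ s ∈ Ico (0:ℝ) 1, F s ≤ I := by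
    intro s hs
    have h1 : F s + ∫ t in s..1, D.M t = I :=
      intervalIntegral.integral_add_adjacent_intervals (hsub s ⟨hs.1, hs.2.le⟩)
        (hsub1 s ⟨hs.1, hs.2.le⟩)
    have h2 : 0 ≤ ∫ t in s..1, D.M t := by
      rw [intervalIntegral.integral_of_le hs.2.le, integral_Ioc_eq_integral_Ioo]
      apply setIntegral_nonneg measurableSet_Ioo
      intro x hx
      linarith [aux_M_one D (hs.1.trans hx.1.le) hx.2]
    linarith
  have hI0 : 0 ≤ I := (hFn 0 (by norm_num)).trans (hFI 0 (by norm_num))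
  set C1 : ℝ := 1 + m ^ 2 with hC1
  set C2 : ℝ := m ^ 2 / δ with hC2
  set C3 : ℝ := L / δ with hC3
  have hC20 : 0 ≤ C2 := by positivity
  have hC30 : 0 ≤ C3 := by positivity
  have hC10 : 0 < C1 := by positivity
  refine ⟨2 * (C1 + C2 + C3 + 2 * (1 + I) * I), by positivity, ?_⟩
  intro a ha β hβ G p p' hGc hpc hGd hpd hMc hode
  have ha0 : 0 < a := by linarith
  have hFd : ∀ s ∈ Ioo (0:ℝ) 1, HasDerivAt F (D.M s) s := by
    intro s hs
    exact intervalIntegral.integral_hasDerivAt_right (hsub s ⟨hs.1.le, hs.2.le⟩)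
      (hMc.stronglyMeasurableAtFilter isOpen_Ioo s hs) (hMc.continuousAt (isOpen_Ioo.mem_nhds hs))
  -- the function h
  set h : ℝ → ℝ := fun y => y * p y / β with hh
  set h' : ℝ → ℝ := fun y =>
    y * (D.psi (y / a) + D.M (y / a) ^ 2 / a ^ 2 - D.phi (y / a) * h y) with hh'
  have hhc : ContinuousOn h (Icc 0 a) := (continuousOn_id.mul hpc).div_const _
  have hhd : ∀ y ∈ Ioo 0 a, HasDerivAt h (h' y) y := by
    intro y hy
    have h1 := ((hasDerivAt_id y).mul (hpd y hy)).div_const β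
    refine HasDerivAt.congr_deriv (f := h) h1 ?_
    have h2 := hode y hy
    have hy0 : y ≠ 0 := hy.1.ne'
    have h3 : p' y = β * (D.psi (y / a) + D.M (y / a) ^ 2 / a ^ 2)
      - (1 / y + y * D.phi (y / a)) * p y := by linarith
    simp only [hh', hh, id, h3]
    field_simp
    ring
  have hh0 : h 0 = 0 := by simp [hh]
  have hdiv : ∀ y ∈ Ioo 0 a, 0 < y / a ∧ y / a < 1 := fun y hy =>
    ⟨div_pos hy.1 ha0, (div_lt_one ha0).2 hy.2⟩
  have hS : ∀ y ∈ Ioo 0 a, 0 < D.psi (y / a) + D.M (y / a) ^ 2 / a ^ 2 := by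
    intro y hy
    obtain ⟨h1, h2⟩ := hdiv y hy
    have h3 := aux_M_one D h1.le h2
    have h4 := D.psi_nonneg _ ⟨h1.le, h2.le⟩
    positivity
  have hphi : ∀ y ∈ Ioo 0 a, 0 < D.phi (y / a) := fun y hy =>
    D.phi_pos _ ⟨(hdiv y hy).1.le, (hdiv y hy).2⟩
  have hhn : ∀ y ∈ Icc 0 a, 0 ≤ h y := by
    intro y hy
    have := aux_cmp (fun y => - h y) (fun y => - h' y) a hhc.neg (fun y hy => (hhd y hy).neg)
      (by simp [hh0]) (by
        intro y hy hneg
        have h1 := hS y hy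
        have h2 := hphi y hy
        have h3 := hy.1
        have h4 : 0 < D.phi (y / a) * (- h y) := mul_pos h2 hneg
        have : 0 ≤ h' y := mul_nonneg h3.le (by nlinarith)
        linarith) y hy
    linarith
  have hhpos : ∀ y ∈ Ioo 0 a, 0 < h y := by
    intro y hy
    refine lt_of_le_of_ne (hhn y ⟨hy.1.le, hy.2.le⟩) ?_
    intro heq
    have hmin : IsLocalMin h y := by
      filter_upwards [isOpen_Ioo.mem_nhds hy] with x hx
      rw [← heq]
      exact hhn x ⟨hx.1.le, hx.2.le⟩
    have h1 := hmin.hasDerivAt_eq_zero (hhd y hy)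
    have h2 : 0 < h' y := by
      simp only [hh', ← heq, mul_zero, sub_zero]
      exact mul_pos hy.1 (hS y hy)
    linarith
  have hp_eq : ∀ y ∈ Ioo 0 a, p y = β * (h y / y) := by
    intro y hy
    have := hy.1.ne'
    simp only [hh]
    field_simp
  refine ⟨fun y hy => by rw [hp_eq y hy]; exact mul_pos hβ (div_pos (hhpos y hy) hy.1), ?_⟩
  have hM2 : ∀ y ∈ Ioc 0 (a / 2), D.M (y / a) ≤ m := by
    intro y hy
    exact aux_M_mono D (div_pos hy.1 ha0).le (by rw [div_le_iff₀ ha0]; linarith [hy.2]) (by norm_num)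
  -- bound near zero
  have b1 : ∀ y ∈ Icc 0 (a / 2), h y - C1 * y ^ 2 / 2 ≤ 0 := by
    apply aux_cmp _ (fun y => h' y - C1 * y) (a / 2)
    · exact (hhc.mono (Icc_subset_Icc_right (by linarith))).sub (by fun_prop)
    · intro y hy
      refine (hhd y ⟨hy.1, by linarith [hy.2]⟩).sub ?_
      have := (((hasDerivAt_id y).pow 2).const_mul C1).div_const 2
      refine HasDerivAt.congr_deriv (f := fun y => C1 * y ^ 2 / 2) this ?_
      simp only [id, Nat.cast_ofNat, Nat.add_one_sub_one, pow_one, mul_one]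
      ring
    · simp [hh0]
    · intro y hy _
      have hy' : y ∈ Ioo 0 a := ⟨hy.1, by linarith [hy.2]⟩
      obtain ⟨e1, e2⟩ := hdiv y hy'
      have e3 : D.psi (y / a) ≤ 1 := by
        rw [← D.psi_zero]
        exact D.psi_anti (by norm_num) ⟨e1.le, e2.le⟩ e1.le
      have e4 : D.M (y / a) ^ 2 / a ^ 2 ≤ m ^ 2 := by
        have e5 := aux_M_one D e1.le e2
        have e6 := hM2 y ⟨hy.1, hy.2.le⟩
        rw [div_le_iff₀ (by positivity)]
        have : D.M (y / a) ^ 2 ≤ m ^ 2 := by gcongr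
        have : 1 ≤ a ^ 2 := by nlinarith
        nlinarith [sq_nonneg m]
      have e7 : 0 ≤ D.phi (y / a) * h y := mul_nonneg (hphi y hy').le (hhpos y hy').le
      have : h' y ≤ y * C1 := mul_le_mul_of_nonneg_left (by linarith) hy.1.le
      linarith
  -- middle bound
  have b2 : ∀ y ∈ Ioc 0 (a / 2), h y ≤ 1 + C3 * (y / a) + C2 / a ^ 2 := by
    intro y0 hy0
    have d1 : 0 < y0 / a := div_pos hy0.1 ha0
    have d2 : y0 / a ≤ 1 / 2 := by rw [div_le_iff₀ ha0]; linarith [hy0.2]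
    have d3 : δ ≤ D.phi (y0 / a) := D.phi_anti ⟨d1.le, by linarith⟩ (by norm_num) d2
    have d4 : 0 < D.phi (y0 / a) := by linarith
    have d5 : 1 / D.phi (y0 / a) ≤ 1 + C3 * (y0 / a) := by
      have d6 := hL.dist_le_mul 0 (by norm_num) (y0 / a) ⟨d1.le, by linarith⟩
      rw [Real.dist_eq, Real.dist_eq, D.phi_zero] at d6
      have d7 : 1 - D.phi (y0 / a) ≤ L * (y0 / a) := by
        refine (le_abs_self _).trans (d6.trans_eq ?_)
        rw [zero_sub, abs_neg, abs_of_pos d1]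
      rw [div_le_iff₀ d4]
      have d8 : C3 * δ = L := by simp only [hC3]; field_simp
      have d9 : C3 * (y0 / a) * δ ≤ C3 * (y0 / a) * D.phi (y0 / a) :=
        mul_le_mul_of_nonneg_left d3 (by positivity)
      have : C3 * (y0 / a) * δ = L * (y0 / a) := by rw [← d8]; ring
      linarith
    have := aux_cmp (fun y => h y - (1 / D.phi (y0 / a) + C2 / a ^ 2)) h' y0
      ((hhc.mono (Icc_subset_Icc_right (by linarith [hy0.2]))).sub continuousOn_const)
      (fun y hy => (hhd y ⟨hy.1, by linarith [hy.2, hy0.2]⟩).sub_const _)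
      (by
        have : 0 ≤ 1 / D.phi (y0 / a) := by positivity
        have : 0 ≤ C2 / a ^ 2 := by positivity
        simp only [hh0]; linarith)
      (by
        intro y hy hgt
        have hy' : y ∈ Ioo 0 a := ⟨hy.1, by linarith [hy.2, hy0.2]⟩
        obtain ⟨e1, e2⟩ := hdiv y hy'
        have e3 : D.psi (y / a) ≤ 1 := by
          rw [← D.psi_zero]
          exact D.psi_anti (by norm_num) ⟨e1.le, e2.le⟩ e1.le
        have e4 : D.M (y / a) ^ 2 / a ^ 2 ≤ m ^ 2 / a ^ 2 := by
          have e5 := aux_M_one D e1.le e2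
          have e6 := hM2 y ⟨hy.1, by linarith [hy.2, hy0.2]⟩
          gcongr
        have e8 : y / a ≤ y0 / a := by gcongr; exact hy.2.le
        have e9 : D.phi (y0 / a) ≤ D.phi (y / a) :=
          D.phi_anti ⟨e1.le, e2.le⟩ ⟨d1.le, by linarith⟩ e8
        have e10 : 1 ≤ D.phi (y / a) * (1 / D.phi (y0 / a)) := by
          rw [mul_one_div, le_div_iff₀ d4]; linarith
        have e11 : m ^ 2 / a ^ 2 ≤ D.phi (y / a) * (C2 / a ^ 2) := by
          have : m ^ 2 / a ^ 2 = δ * (C2 / a ^ 2) := by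
            simp only [hC2]; field_simp
          rw [this]
          exact mul_le_mul_of_nonneg_right (by linarith) (by positivity)
        have e12 := mul_lt_mul_of_pos_left (sub_pos.1 hgt) (hphi y hy')
        rw [mul_add] at e12
        exact mul_nonpos_of_nonneg_of_nonpos hy.1.le (by linarith))
      y0 ⟨hy0.1.le, le_refl _⟩
    beta_reduce at this
    linarith
  -- outer bound
  have b3 : ∀ y ∈ Ioo 0 a, h y ≤ D.M (y / a) * (1 + I) := by
    intro y0 hy0
    obtain ⟨d1, d2⟩ := hdiv y0 hy0
    set M0 := D.M (y0 / a) with hM0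
    have hM01 : 1 ≤ M0 := aux_M_one D d1.le d2
    have := aux_cmp (fun y => h y - M0 * (1 + F (y / a)))
      (fun y => h' y - M0 * (D.M (y / a) * (1 / a))) y0
      (by
        refine (hhc.mono (Icc_subset_Icc_right hy0.2.le)).sub
          (continuousOn_const.mul (continuousOn_const.add
            (hFc.comp (by fun_prop) ?_)))
        intro y hy
        exact ⟨div_nonneg hy.1 ha0.le, (div_le_one ha0).2 (hy.2.trans hy0.2.le)⟩)
      (by
        intro y hy
        have hy' : y ∈ Ioo 0 a := ⟨hy.1, by linarith [hy.2, hy0.2]⟩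
        refine (hhd y hy').sub (HasDerivAt.const_mul _ (HasDerivAt.const_add _ ?_))
        exact (hFd _ (hdiv y hy')).comp y ((hasDerivAt_id y).div_const a))
      (by simp only [hh0, zero_div, hF0]; linarith)
      (by
        intro y hy hgt
        have hy' : y ∈ Ioo 0 a := ⟨hy.1, by linarith [hy.2, hy0.2]⟩
        obtain ⟨e1, e2⟩ := hdiv y hy'
        have e8 : y / a ≤ y0 / a := by gcongr; exact hy.2.le
        have e3 := aux_psi_le D e1.le e8 d2
        have e4 := hFn _ ⟨e1.le, e2⟩
        have e5 : M0 < h y := by nlinarith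
        have e6 := mul_lt_mul_of_pos_left e5 (hphi y hy')
        have e7 := aux_M_one D e1.le e2
        have e9 := aux_M_mono D e1.le e8 d2
        have e10 : y * (D.M (y / a) ^ 2 / a ^ 2) ≤ M0 * (D.M (y / a) * (1 / a)) := by
          have : y * (D.M (y / a) ^ 2 / a ^ 2) = (y / a) * D.M (y / a) * (D.M (y / a) * (1 / a)) := by
            field_simp
          rw [this]
          apply mul_le_mul_of_nonneg_right _ (by positivity)
          nlinarith
        have e11 : y * (D.psi (y / a) - D.phi (y / a) * h y) ≤ 0 :=
          mul_nonpos_of_nonneg_of_nonpos hy.1.le (by linarith)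
        have e12 : h' y = y * (D.psi (y / a) - D.phi (y / a) * h y)
          + y * (D.M (y / a) ^ 2 / a ^ 2) := by simp only [hh']; ring
        rw [e12]; linarith)
      y0 ⟨hy0.1.le, le_refl _⟩
    beta_reduce at this
    have h3 := mul_le_mul_of_nonneg_left (hFI _ ⟨d1.le, d2⟩) (by linarith : 0 ≤ M0)
    nlinarith
  -- integrate
  have i1 : G 1 - G 0 ≤ β * C1 := by
    have := aux_inc G p (fun y => β * C1 * y) (fun _ => β * C1) 0 1 zero_le_one
      (hGc.mono (Icc_subset_Icc_right (by linarith))) (by fun_prop)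
      (fun y hy => hGd y ⟨hy.1, by linarith [hy.2]⟩)
      (fun y hy => by simpa using (hasDerivAt_id y).const_mul (β * C1))
      (by
        intro y hy
        have hy' : y ∈ Ioo 0 a := ⟨hy.1, by linarith [hy.2]⟩
        rw [hp_eq y hy']
        apply mul_le_mul_of_nonneg_left _ hβ.le
        rw [div_le_iff₀ hy.1]
        have h1 := b1 y ⟨hy.1.le, by linarith [hy.2]⟩
        have h2 : y ^ 2 ≤ y := by nlinarith [hy.1, hy.2]
        have h3 := mul_le_mul_of_nonneg_left h2 hC10.le
        have h4 := mul_pos hC10 hy.1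
        linarith)
    simpa using this
  have i2 : G (a / 2) - G 1 ≤ β * ((1 + C2 / a ^ 2) * Real.log (a / 2) + C3 * (1 / a) * (a / 2)
      - C3 * (1 / a)) := by
    have := aux_inc G p (fun y => β * ((1 + C2 / a ^ 2) * Real.log y + C3 * (1 / a) * y))
      (fun y => β * ((1 + C2 / a ^ 2) * y⁻¹ + C3 * (1 / a))) 1 (a / 2) (by linarith)
      (hGc.mono (Icc_subset_Icc (by linarith) (by linarith)))
      (by
        refine continuousOn_const.mul ((continuousOn_const.mul ?_).add (by fun_prop))
        exact Real.continuousOn_log.mono (fun y hy => by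
          have := hy.1
          simp only [mem_compl_iff, mem_singleton_iff]
          linarith))
      (fun y hy => hGd y ⟨by linarith [hy.1], by linarith [hy.2]⟩)
      (fun y hy => by
        have h1 : y ≠ 0 := by linarith [hy.1]
        have h2 := (hasDerivAt_id y).const_mul (C3 * (1 / a))
        rw [mul_one] at h2
        exact (((Real.hasDerivAt_log h1).const_mul _).add h2).const_mul β)
      (by
        intro y hy
        have hy0 : 0 < y := by linarith [hy.1]
        have hy' : y ∈ Ioo 0 a := ⟨hy0, by linarith [hy.2]⟩
        rw [hp_eq y hy']
        apply mul_le_mul_of_nonneg_left _ hβ.le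
        rw [div_le_iff₀ hy0]
        have h1 := b2 y ⟨hy0, by linarith [hy.2]⟩
        refine h1.trans_eq ?_
        field_simp
        ring)
    simp only [Real.log_one] at this
    refine this.trans_eq ?_
    ring
  have i3 : G a - G (a / 2) ≤ β * (2 * (1 + I) * I) := by
    have := aux_inc G p (fun y => β * (2 * (1 + I) * F (y / a)))
      (fun y => β * (2 * (1 + I) * (D.M (y / a) * (1 / a)))) (a / 2) a (by linarith)
      (hGc.mono (Icc_subset_Icc (by linarith) (by linarith)))
      (by
        refine continuousOn_const.mul (continuousOn_const.mul (hFc.comp (by fun_prop) ?_))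
        intro y hy
        exact ⟨div_nonneg (by linarith [hy.1]) ha0.le, (div_le_one ha0).2 hy.2⟩)
      (fun y hy => hGd y ⟨by linarith [hy.1], by linarith [hy.2]⟩)
      (fun y hy => by
        have hy' : y ∈ Ioo 0 a := ⟨by linarith [hy.1], hy.2⟩
        refine HasDerivAt.const_mul _ (HasDerivAt.const_mul _ ?_)
        exact (hFd _ (hdiv y hy')).comp y ((hasDerivAt_id y).div_const a))
      (by
        intro y hy
        have hy0 : 0 < y := by linarith [hy.1]
        have hy' : y ∈ Ioo 0 a := ⟨hy0, hy.2⟩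
        obtain ⟨e1, e2⟩ := hdiv y hy'
        have e7 := aux_M_one D e1.le e2
        rw [hp_eq y hy']
        apply mul_le_mul_of_nonneg_left _ hβ.le
        rw [div_le_iff₀ hy0]
        refine (b3 y hy').trans ?_
        have e9 : 1 ≤ 2 * (y / a) := by
          have : 1 / 2 ≤ y / a := by rw [le_div_iff₀ ha0]; linarith [hy.1]
          linarith
        have e10 : 2 * (1 + I) * (D.M (y / a) * (1 / a)) * y
          = D.M (y / a) * (1 + I) * (2 * (y / a)) := by field_simp
        rw [e10]
        exact le_mul_of_one_le_right (by positivity) e9)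
    have h1 : a / a = 1 := div_self ha0.ne'
    have h2 : a / 2 / a = 1 / 2 := by field_simp
    simp only [h1, h2] at this
    have h3 : 0 ≤ β * (2 * (1 + I) * F (1 / 2)) := by
      have := hFn (1 / 2) (by norm_num)
      positivity
    linarith
  have hlog : (1 + C2 / a ^ 2) * Real.log (a / 2) + C3 * (1 / a) * (a / 2) - C3 * (1 / a)
      ≤ Real.log a + C2 + C3 := by
    have l1 : Real.log (a / 2) ≤ Real.log a := Real.log_le_log (by linarith) (by linarith)
    have l2 : Real.log (a / 2) ≤ a ^ 2 := by
      have := Real.log_le_sub_one_of_pos (show 0 < a / 2 by linarith)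
      nlinarith
    have l3 : C2 / a ^ 2 * Real.log (a / 2) ≤ C2 := by
      rw [div_mul_eq_mul_div, div_le_iff₀ (by positivity)]
      exact mul_le_mul_of_nonneg_left l2 hC20
    have l4 : C3 * (1 / a) * (a / 2) = C3 / 2 := by field_simp
    have l5 : 0 ≤ C3 * (1 / a) := by positivity
    rw [l4]
    linarith
  have := mul_le_mul_of_nonneg_left hlog hβ.le
  have hfin : β * (Real.log a + 2 * (C1 + C2 + C3 + 2 * (1 + I) * I) / 2)
    = β * C1 + β * (Real.log a + C2 + C3) + β * (2 * (1 + I) * I) := by ring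
  rw [hfin]
  linarith

/-- For every `w > 0` there are `c > 0` and `α₀` such that for
`α ≥ α₀`: any solution `G̃` of the linear problem
`G̃'' + (1/y + y φ_α(y)) G̃' = β_w (ψ_α(y) + M_α(y)²/α)` on `(0,√α)` with
`G̃'(0) = 0`, `G̃(√α) = K`, where `β_w = 2(K - ε_w)/(log α + c)` and
`ε_w = ∫_w^∞ ds/f(s)`, is strictly increasing on `[0,√α]` and satisfies
`G̃ ≥ ε_w > 0` there. -/
theorem linear_subsolution_positive (D : GelfandData) (w : ℝ) (hw : 0 < w) :
    ∃ c > (0:ℝ), ∃ α₀ : ℝ, ∀ α ≥ α₀, ∀ Gt : ℝ → ℝ,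
      ContDiffOn ℝ 1 Gt (Icc 0 (Real.sqrt α)) →
      ContDiffOn ℝ 2 Gt (Ioo 0 (Real.sqrt α)) →
      (∀ y ∈ Ioo (0:ℝ) (Real.sqrt α),
        derivWithin (derivWithin Gt (Icc 0 (Real.sqrt α))) (Ioo 0 (Real.sqrt α)) y
          + (1 / y + y * D.phi (y / Real.sqrt α))
              * derivWithin Gt (Icc 0 (Real.sqrt α)) y
        = 2 * (D.K - ∫ s in Ioi w, 1 / D.f s) / (Real.log α + c)
            * (D.psi (y / Real.sqrt α) + (D.M (y / Real.sqrt α)) ^ 2 / α)) →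
      derivWithin Gt (Icc 0 (Real.sqrt α)) 0 = 0 →
      Gt (Real.sqrt α) = D.K →
      StrictMonoOn Gt (Icc 0 (Real.sqrt α)) ∧
      (0 < ∫ s in Ioi w, 1 / D.f s) ∧
      ∀ y ∈ Icc (0:ℝ) (Real.sqrt α), (∫ s in Ioi w, 1 / D.f s) ≤ Gt y := by
  obtain ⟨c, hc, hcore⟩ := aux_core D
  have hfi : IntegrableOn (fun s => 1 / D.f s) (Ioi w) :=
    D.f_int.mono_set (Ioi_subset_Ioi hw.le)
  have hεpos : 0 < ∫ s in Ioi w, 1 / D.f s := by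
    rw [setIntegral_pos_iff_support_of_nonneg_ae]
    · refine lt_of_lt_of_le (b := volume (Ioi w)) (by simp) (measure_mono ?_)
      intro s hs
      refine ⟨?_, hs⟩
      have := D.f_pos s (hw.le.trans (le_of_lt hs))
      simp only [Function.mem_support]
      positivity
    · filter_upwards [ae_restrict_mem measurableSet_Ioi] with s hs
      have := D.f_pos s (hw.le.trans (le_of_lt hs))
      simp only [Pi.zero_apply]
      positivity
    · exact hfi
  have hκ : 0 < D.K - ∫ s in Ioi w, 1 / D.f s := by
    have hfi0 : IntegrableOn (fun s => 1 / D.f s) (Ioc 0 w) :=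
      D.f_int.mono_set Ioc_subset_Ioi_self
    have h1 : D.K = (∫ s in Ioc 0 w, 1 / D.f s) + ∫ s in Ioi w, 1 / D.f s := by
      rw [D.K_def, ← setIntegral_union Ioc_disjoint_Ioi_same measurableSet_Ioi hfi0 hfi,
        Ioc_union_Ioi_eq_Ioi hw.le]
    have h2 : 0 < ∫ s in Ioc 0 w, 1 / D.f s := by
      rw [setIntegral_pos_iff_support_of_nonneg_ae]
      · refine lt_of_lt_of_le (b := volume (Ioc 0 w)) (by simpa using hw) (measure_mono ?_)
        intro s hs
        refine ⟨?_, hs⟩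
        have := D.f_pos s hs.1.le
        simp only [Function.mem_support]
        positivity
      · filter_upwards [ae_restrict_mem measurableSet_Ioc] with s hs
        have := D.f_pos s hs.1.le
        simp only [Pi.zero_apply]
        positivity
      · exact hfi0
    linarith
  generalize (∫ s in Ioi w, 1 / D.f s) = ε at *
  refine ⟨c, hc, 4, ?_⟩
  intro α hα G hG1 hG2 hode _ hGK
  have ha : 2 ≤ Real.sqrt α := Real.le_sqrt_of_sq_le (by linarith)
  have hsq : α = Real.sqrt α ^ 2 := (Real.sq_sqrt (by linarith)).symm
  have hlogα : Real.log α = 2 * Real.log (Real.sqrt α) := by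
    rw [Real.log_sqrt (by linarith)]; ring
  have hden : 0 < Real.log α + c := by
    have := Real.log_nonneg (show 1 ≤ α by linarith)
    linarith
  set a := Real.sqrt α with hadef
  have ha0 : 0 < a := by linarith
  set β := 2 * (D.K - ε) / (Real.log α + c) with hβdef
  have hβ : 0 < β := by positivity
  set p := derivWithin G (Icc 0 a) with hp
  set p' := derivWithin p (Ioo 0 a) with hp'
  have hpc : ContinuousOn p (Icc 0 a) :=
    hG1.continuousOn_derivWithin (uniqueDiffOn_Icc ha0) le_rfl
  have hGd : ∀ y ∈ Ioo 0 a, HasDerivAt G (p y) y := by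
    intro y hy
    have := (hG1.differentiableOn one_ne_zero y ⟨hy.1.le, hy.2.le⟩).hasDerivWithinAt
    exact this.hasDerivAt (Icc_mem_nhds hy.1 hy.2)
  have hpC : ContDiffOn ℝ 1 p (Ioo 0 a) := by
    have h1 : ContDiffOn ℝ 1 (deriv G) (Ioo 0 a) :=
      hG2.deriv_of_isOpen isOpen_Ioo (by norm_num)
    exact h1.congr (fun y hy => (hGd y hy).deriv.symm)
  have hpd : ∀ y ∈ Ioo 0 a, HasDerivAt p (p' y) y := by
    intro y hy
    exact ((hpC.differentiableOn one_ne_zero y hy).hasDerivWithinAt).hasDerivAt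
      (isOpen_Ioo.mem_nhds hy)
  have hp'c : ContinuousOn p' (Ioo 0 a) :=
    hpC.continuousOn_derivWithin isOpen_Ioo.uniqueDiffOn le_rfl
  have hode2 : ∀ y ∈ Ioo 0 a, p' y + (1 / y + y * D.phi (y / a)) * p y
      = β * (D.psi (y / a) + D.M (y / a) ^ 2 / a ^ 2) := by
    intro y hy
    rw [← hsq]
    exact hode y hy
  have hMc : ContinuousOn D.M (Ioo 0 1) := by
    obtain ⟨L1, hL1⟩ := D.phi_lip
    obtain ⟨L2, hL2⟩ := D.psi_lip
    have c1 : ContinuousOn D.phi (Ioo 0 1) := hL1.continuousOn.mono Ioo_subset_Icc_self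
    have c2 : ContinuousOn D.psi (Ioo 0 1) := hL2.continuousOn.mono Ioo_subset_Icc_self
    have hmaps : MapsTo (fun s : ℝ => s * a) (Ioo 0 1) (Ioo 0 a) := fun s hs =>
      ⟨mul_pos hs.1 ha0, by nlinarith [hs.2]⟩
    have c3 : ContinuousOn (fun s => p' (s * a)) (Ioo 0 1) := hp'c.comp (by fun_prop) hmaps
    have c4 : ContinuousOn (fun s => p (s * a)) (Ioo 0 1) :=
      (hpc.mono Ioo_subset_Icc_self).comp (by fun_prop) hmaps
    have c5 : ContinuousOn (fun s : ℝ => 1 / (s * a)) (Ioo 0 1) :=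
      continuousOn_const.div (by fun_prop) (fun s hs => (hmaps hs).1.ne')
    have c6 : ContinuousOn (fun s => Real.sqrt (a ^ 2 * ((p' (s * a) +
        (1 / (s * a) + s * a * D.phi s) * p (s * a)) / β - D.psi s))) (Ioo 0 1) := by
      apply ContinuousOn.sqrt
      have c7 : ContinuousOn (fun s : ℝ => s * a * D.phi s) (Ioo 0 1) :=
        ContinuousOn.mul (by fun_prop) c1
      exact continuousOn_const.mul (((c3.add ((c5.add c7).mul c4)).div_const β).sub c2)
    refine c6.congr ?_
    intro s hs
    have h1 := hode2 (s * a) (hmaps hs)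
    have h2 : s * a / a = s := by field_simp
    rw [h2] at h1
    simp only
    rw [h1]
    have h3 : a ^ 2 * (β * (D.psi s + D.M s ^ 2 / a ^ 2) / β - D.psi s) = D.M s ^ 2 := by
      field_simp
      ring
    rw [h3, Real.sqrt_sq]
    linarith [aux_M_one D hs.1.le hs.2]
  obtain ⟨hpos, hbound⟩ := hcore a ha β hβ G p p' hG1.continuousOn hpc hGd hpd hMc hode2
  have hmono : StrictMonoOn G (Icc 0 a) := by
    apply strictMonoOn_of_hasDerivWithinAt_pos (convex_Icc 0 a) hG1.continuousOn (f' := p)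
    · intro y hy
      rw [interior_Icc] at hy
      exact (hGd y hy).hasDerivWithinAt
    · intro y hy
      rw [interior_Icc] at hy
      exact hpos y hy
  refine ⟨hmono, hεpos, ?_⟩
  intro y hy
  have h1 := hmono.monotoneOn ⟨le_refl 0, ha0.le⟩ hy hy.1
  have h2 : β * (Real.log a + c / 2) = D.K - ε := by
    have : Real.log a + c / 2 = (Real.log α + c) / 2 := by rw [hlogα]; ring
    rw [this, hβdef]
    field_simp
  linarith
end
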